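/- There exist R ∈ ℕ, B' ≥ 1 and 0 ≤ σ < 1 such that: for any m ∈ ℕ, any pair ξ, η ∈ ∂Γ with (ξ|η) > 3R(m+2), and any geodesic ray {x(n)}_{n≥0} ∈ [e,ξ], the function φ(g) = K(g,ξ)/K(g,η) satisfies |φ(g) − φ(h)| ≤ B'·σ^{k−1} for all g, h ∈ C_{3R(k+1)}(p) and all 1 ≤ k ≤ m, where p = x(3R(m+2)). -/

import Mathlib

open Filter Topology MeasureTheory
open scoped ENNReal

namespace HarmonicBoundary

variable {Γ : Type} [Group Γ]

/-- Word length of `g` with respect to a generating set `S`. -/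
noncomputable def wl (S : Set Γ) (g : Γ) : ℕ :=
  sInf {n : ℕ | ∃ w : List Γ, w.length = n ∧ (∀ x ∈ w, x ∈ S) ∧ w.prod = g}

/-- Word metric `d(x,y) = |x⁻¹y|`. -/
noncomputable def wdist (S : Set Γ) (x y : Γ) : ℕ := wl S (x⁻¹ * y)

/-- Gromov product `(x|y)_z = (d(x,z)+d(y,z)-d(x,y))/2`. -/
noncomputable def gp (S : Set Γ) (z x y : Γ) : ℝ :=
  ((wdist S x z : ℝ) + (wdist S y z : ℝ) - (wdist S x y : ℝ)) / 2

/-- `S` is a finite symmetric generating set of `Γ`. -/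
def IsGenSet (S : Set Γ) : Prop :=
  S.Finite ∧ (∀ s ∈ S, s⁻¹ ∈ S) ∧ Subgroup.closure S = ⊤

/-- `Γ` is `δ`-hyperbolic with respect to the word metric of `S`:
`(x|y) ≥ min ((x|z), (y|z)) - δ` for all `x y z`. -/
def IsHyperbolic (S : Set Γ) (δ : ℝ) : Prop :=
  0 ≤ δ ∧ ∀ x y z : Γ, min (gp S 1 x z) (gp S 1 y z) - δ ≤ gp S 1 x y

/-- `Γ` is nonelementary: it has no cyclic subgroup of finite index. -/
def Nonelementary (Γ : Type) [Group Γ] : Prop :=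
  ∀ g : Γ, (Subgroup.zpowers g).index = 0

/-- A sequence converges to infinity if `(x_i|x_j) → ∞`. -/
def ConvInf (S : Set Γ) (u : ℕ → Γ) : Prop :=
  Tendsto (fun p : ℕ × ℕ => gp S 1 (u p.1) (u p.2)) atTop atTop

/-- Two sequences converging to infinity are equivalent if `(x_i|y_j) → ∞`. -/
def EquivSeq (S : Set Γ) (u v : ℕ → Γ) : Prop :=
  Tendsto (fun p : ℕ × ℕ => gp S 1 (u p.1) (v p.2)) atTop atTop

/-- An (abstract model of the) Gromov boundary of `Γ`: the points are exactly the
classes of sequences converging to infinity, modulo the equivalence `EquivSeq`,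
together with the natural left action of `Γ`. -/
structure Boundary (Γ : Type) [Group Γ] (S : Set Γ) where
  pt : Type
  cls : (ℕ → Γ) → pt
  cls_surj : ∀ ξ : pt, ∃ u : ℕ → Γ, ConvInf S u ∧ cls u = ξ
  cls_eq : ∀ u v : ℕ → Γ, ConvInf S u → ConvInf S v → (cls u = cls v ↔ EquivSeq S u v)
  smul : Γ → pt → pt
  smul_cls : ∀ (g : Γ) (u : ℕ → Γ), ConvInf S u → smul g (cls u) = cls fun n => g * u n

/-- Extension of the Gromov product to the boundary:
`(ξ|η) = sup liminf (x_i|y_j)` over sequences representing `ξ` and `η`,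
as an extended nonnegative real. -/
noncomputable def bgp {S : Set Γ} (B : Boundary Γ S) (ξ η : B.pt) : ℝ≥0∞ :=
  ⨆ (u : {u : ℕ → Γ // ConvInf S u ∧ B.cls u = ξ})
    (v : {v : ℕ → Γ // ConvInf S v ∧ B.cls v = η}),
    Filter.liminf (fun p : ℕ × ℕ => ENNReal.ofReal (gp S 1 (u.1 p.1) (v.1 p.2))) atTop

/-- Real-valued Gromov product on the boundary (finite for `ξ ≠ η`). -/
noncomputable def bgpR {S : Set Γ} (B : Boundary Γ S) (ξ η : B.pt) : ℝ := (bgp B ξ η).toReal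

/-- The canonical topology of the Gromov boundary: a set is open iff around each of
its points it contains a basic neighbourhood `V_r(p) = {q | (q|p) > r}`. -/
def btop {S : Set Γ} (B : Boundary Γ S) : TopologicalSpace B.pt where
  IsOpen O := ∀ p ∈ O, ∃ r : ℝ≥0∞, r ≠ ⊤ ∧ {q | r < bgp B q p} ⊆ O
  isOpen_univ := fun p _ => ⟨0, ENNReal.zero_ne_top, fun q _ => trivial⟩
  isOpen_inter := by
    intro A A' hA hA' p hp
    obtain ⟨r1, hr1, h1⟩ := hA p hp.1
    obtain ⟨r2, hr2, h2⟩ := hA' p hp.2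
    refine ⟨max r1 r2, (max_lt hr1.lt_top hr2.lt_top).ne, fun q hq => ?_⟩
    have hq' : max r1 r2 < bgp B q p := hq
    exact ⟨h1 (show r1 < bgp B q p from (le_max_left r1 r2).trans_lt hq'),
      h2 (show r2 < bgp B q p from (le_max_right r1 r2).trans_lt hq')⟩
  isOpen_sUnion := by
    intro s hs p hp
    obtain ⟨t, ht, hpt⟩ := hp
    obtain ⟨r, hr, hsub⟩ := hs t ht p hpt
    exact ⟨r, hr, fun q hq => ⟨t, ht, hsub hq⟩⟩

/-- The attracting fixed point `g⁺ = lim_n gⁿ` of an (infinite order) element. -/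
def plusPt {S : Set Γ} (B : Boundary Γ S) (g : Γ) : B.pt := B.cls fun n => g ^ n

/-- The repelling fixed point `g⁻ = lim_n g⁻ⁿ` of an (infinite order) element. -/
def minusPt {S : Set Γ} (B : Boundary Γ S) (g : Γ) : B.pt := B.cls fun n => g⁻¹ ^ n

/-- A geodesic ray starting at the identity. -/
def IsGeodesicRay (S : Set Γ) (x : ℕ → Γ) : Prop :=
  x 0 = 1 ∧ ∀ m n : ℕ, wdist S (x m) (x n) = Nat.dist m n

/-- A geodesic ray from `e` to the boundary point `ξ`, i.e. an element of `[e,ξ]`. -/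
def RayTo {S : Set Γ} (B : Boundary Γ S) (x : ℕ → Γ) (ξ : B.pt) : Prop :=
  IsGeodesicRay S x ∧ ConvInf S x ∧ B.cls x = ξ

/-- A geodesic segment from `x` to `y` (parametrized on `0,…,d(x,y)`),
i.e. an element of `[x,y]`. -/
def IsGeodesicSeg (S : Set Γ) (x y : Γ) (α : ℕ → Γ) : Prop :=
  α 0 = x ∧ α (wdist S x y) = y ∧
  ∀ m n : ℕ, m ≤ wdist S x y → n ≤ wdist S x y → wdist S (α m) (α n) = Nat.dist m n

/-- The boundary "cylinder" `U(ξ,R)`: all `η` such that for every pair of geodesic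
rays `x ∈ [e,ξ]`, `y ∈ [e,η]` one has `lim_n (x(n)|y(n)) > R` (the sequence
`(x(n)|y(n))` is nondecreasing, so the limit exceeds `R` iff some term does). -/
def Uset {S : Set Γ} (B : Boundary Γ S) (ξ : B.pt) (R : ℝ) : Set B.pt :=
  {η | ∀ x y : ℕ → Γ, RayTo B x ξ → RayTo B y η → ∃ n : ℕ, R < gp S 1 (x n) (y n)}

/-- `C_r(p) = {g | (g|e)_p > r}`. -/
def Cset (S : Set Γ) (p : Γ) (r : ℝ) : Set Γ := {g | r < gp S p g 1}

/-- The `R`-neighbourhood `N(α,R)` of a geodesic segment `α ∈ [x,y]`. -/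
def segN (S : Set Γ) (x y : Γ) (α : ℕ → Γ) (R : ℝ) : Set Γ :=
  {g | ∃ i ≤ wdist S x y, (wdist S g (α i) : ℝ) ≤ R}

/-- The `R`-neighbourhood `N(A,R)` of a subset `A ⊆ Γ`. -/
def setN (S : Set Γ) (A : Set Γ) (R : ℝ) : Set Γ :=
  {g | ∃ a ∈ A, (wdist S g a : ℝ) ≤ R}

/-- `μ` is a nondegenerate probability measure on `Γ` with support contained in `S`:
nonnegative, of total mass one, supported in `S`, and the semigroup generated by its
support is the whole of `Γ`. -/
structure IsRWMeasure (S : Set Γ) (μ : Γ → ℝ) : Prop where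
  nonneg : ∀ g, 0 ≤ μ g
  support_subset : ∀ g, μ g ≠ 0 → g ∈ S
  total : ∑' g : Γ, μ g = 1
  nondeg : ∀ g : Γ, ∃ l : List Γ, l ≠ [] ∧ (∀ x ∈ l, 0 < μ x) ∧ l.prod = g

open Classical in
/-- `n`-step transition probabilities `p⁽ⁿ⁾(x,y) = μ*ⁿ(x⁻¹y)` of the random walk. -/
noncomputable def ptrans (μ : Γ → ℝ) : ℕ → Γ → Γ → ℝ
  | 0 => fun x y => if x = y then 1 else 0
  | n + 1 => fun x y => ∑' z : Γ, ptrans μ n x z * μ (z⁻¹ * y)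

/-- Green function `G(x,y) = Σ_n p⁽ⁿ⁾(x,y)`. -/
noncomputable def green (μ : Γ → ℝ) (x y : Γ) : ℝ := ∑' n : ℕ, ptrans μ n x y

/-- `F(x,y) = G(x,y)/G(y,y)`, the probability that the walk from `x` ever hits `y`. -/
noncomputable def greenF (μ : Γ → ℝ) (x y : Γ) : ℝ := green μ x y / green μ y y

/-- The Martin kernel `K(x,y) = G(x,y)/G(e,y)`. -/
noncomputable def martinK (μ : Γ → ℝ) (x y : Γ) : ℝ := green μ x y / green μ 1 y

open Classical in
/-- Transition probabilities of the walk restricted to `Δ` (killed when leaving `Δ`). -/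
noncomputable def ptransR (μ : Γ → ℝ) (Δ : Set Γ) : ℕ → Γ → Γ → ℝ
  | 0 => fun x y => if x = y ∧ x ∈ Δ then 1 else 0
  | n + 1 => fun x y => if y ∈ Δ then ∑' z : Γ, ptransR μ Δ n x z * μ (z⁻¹ * y) else 0

/-- Green function `G_Δ` of the restricted walk. -/
noncomputable def greenR (μ : Γ → ℝ) (Δ : Set Γ) (x y : Γ) : ℝ := ∑' n : ℕ, ptransR μ Δ n x y

/-- `F_Δ(x,y) = G_Δ(x,y)/G_Δ(y,y)`. -/
noncomputable def greenFR (μ : Γ → ℝ) (Δ : Set Γ) (x y : Γ) : ℝ :=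
  greenR μ Δ x y / greenR μ Δ y y

/-- Generating function `G_Δ(x,y|z) = Σ_n p_Δ⁽ⁿ⁾(x,y) zⁿ`. -/
noncomputable def greenRZ (μ : Γ → ℝ) (Δ : Set Γ) (x y : Γ) (z : ℝ) : ℝ :=
  ∑' n : ℕ, ptransR μ Δ n x y * z ^ n

/-- Spectral radius `ρ(P) = lim_n p⁽ⁿ⁾(e,e)^{1/n}` of the walk. -/
noncomputable def specRad (μ : Γ → ℝ) : ℝ :=
  Filter.limsup (fun n : ℕ => (ptrans μ n 1 1) ^ ((n : ℝ)⁻¹)) atTop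

/-- `u` is harmonic on `Λ`: `Σ_h p(g,h) u(h) = u(g)` for `g ∈ Λ`, `p(g,h)=μ(g⁻¹h)`. -/
def HarmonicOn (μ : Γ → ℝ) (u : Γ → ℝ) (Λ : Set Γ) : Prop :=
  ∀ g ∈ Λ, (∑' h : Γ, μ (g⁻¹ * h) * u h) = u g

/-- `u` vanishes at infinity on `Λ`: `u(g_n) → 0` along sequences in `Λ` with `|g_n|→∞`. -/
def VanishesAtInftyOn (S : Set Γ) (u : Γ → ℝ) (Λ : Set Γ) : Prop :=
  ∀ ε : ℝ, 0 < ε → ∃ M : ℕ, ∀ g ∈ Λ, M ≤ wl S g → |u g| ≤ ε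

open Classical in
/-- `r(g) = K(g⁻¹,g⁺)` for infinite order `g`, and `r(g) = 1` for finite order `g`;
here `Kb` is the boundary extension of the Martin kernel. -/
noncomputable def rfun {S : Set Γ} (B : Boundary Γ S) (Kb : Γ → B.pt → ℝ) (g : Γ) : ℝ :=
  if IsOfFinOrder g then 1 else Kb g⁻¹ (plusPt B g)

/-- The ratio set `r(Γ,∂Γ,ν)`: all `l ≥ 0` such that for every `ε > 0` and every
Borel `A` of positive measure there is `g ∈ Γ` such that
`{ω ∈ gA ∩ A : |d(gν)/dν(ω) − l| < ε}` has positive measure; here the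
Radon–Nikodym derivative `d(gν)/dν` is the Martin kernel `Kb g`. -/
def ratioSet {S : Set Γ} (B : Boundary Γ S) [MeasurableSpace B.pt]
    (ν : Measure B.pt) (Kb : Γ → B.pt → ℝ) : Set ℝ :=
  {l : ℝ | 0 ≤ l ∧ ∀ ε : ℝ, 0 < ε → ∀ A : Set B.pt, MeasurableSet A → 0 < ν A →
    ∃ g : Γ, 0 < ν {ω | ω ∈ A ∧ B.smul g⁻¹ ω ∈ A ∧ |Kb g ω - l| < ε}}

/-- A left invariant finitely additive mean on `Γ`; `Γ` is amenable iff one exists. -/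
structure InvariantMean (Γ : Type) [Group Γ] where
  m : Set Γ → ℝ
  nonneg : ∀ A, 0 ≤ m A
  total : m Set.univ = 1
  fin_add : ∀ A B : Set Γ, Disjoint A B → m (A ∪ B) = m A + m B
  invariant : ∀ (g : Γ) (A : Set Γ), m ((g * ·) ⁻¹' A) = m A


set_option linter.unusedSectionVars false

/-- Abstract properties of the word metric of a hyperbolic group. -/
structure HypMetric (d : Γ → Γ → ℕ) (δ : ℕ) : Prop where
  self : ∀ x, d x x = 0
  comm : ∀ x y, d x y = d y x
  tri : ∀ x y z, d x z ≤ d x y + d y z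
  eq : ∀ x y, d x y = 0 → x = y
  inv : ∀ g x y, d (g * x) (g * y) = d x y
  hyp : ∀ x y z w, d x y + d z w ≤ d x z + d y w + 2 * δ ∨
    d x y + d z w ≤ d y z + d x w + 2 * δ
  geo : ∀ x y, ∃ α : ℕ → Γ, α 0 = x ∧ α (d x y) = y ∧
    ∀ i j, i ≤ j → j ≤ d x y → d (α i) (α j) = j - i
  fin : ∀ n, {g | d 1 g ≤ n}.Finite

theorem exists_word {S : Set Γ} (hS : IsGenSet S) (g : Γ) :
    ∃ w : List Γ, (∀ x ∈ w, x ∈ S) ∧ w.prod = g := by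
  have hg : g ∈ Subgroup.closure S := by rw [hS.2.2]; trivial
  induction hg using Subgroup.closure_induction with
  | mem x hx => exact ⟨[x], by simpa using hx, by simp⟩
  | one => exact ⟨[], by simp, by simp⟩
  | mul x y _ _ h1 h2 =>
    obtain ⟨a, ha, rfl⟩ := h1
    obtain ⟨b, hb, rfl⟩ := h2
    refine ⟨a ++ b, ?_, by simp⟩
    intro x hx
    rcases List.mem_append.1 hx with h | h
    · exact ha x h
    · exact hb x h
  | inv x _ h =>
    obtain ⟨a, ha, rfl⟩ := h
    refine ⟨(a.map (·⁻¹)).reverse, ?_, by rw [List.prod_inv_reverse]⟩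
    intro x hx
    simp only [List.mem_reverse, List.mem_map] at hx
    obtain ⟨y, hy, rfl⟩ := hx
    exact hS.2.1 y (ha y hy)

theorem wl_spec {S : Set Γ} (hS : IsGenSet S) (g : Γ) :
    ∃ w : List Γ, w.length = wl S g ∧ (∀ x ∈ w, x ∈ S) ∧ w.prod = g := by
  obtain ⟨w, h1, h2⟩ := exists_word hS g
  exact Nat.sInf_mem (s := {n : ℕ | ∃ w : List Γ, w.length = n ∧ (∀ x ∈ w, x ∈ S) ∧ w.prod = g})
    ⟨w.length, w, rfl, h1, h2⟩

theorem wl_le {S : Set Γ} (w : List Γ) (h : ∀ x ∈ w, x ∈ S) : wl S w.prod ≤ w.length :=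
  Nat.sInf_le ⟨w, rfl, h, rfl⟩

theorem wl_one {S : Set Γ} : wl S (1 : Γ) = 0 := by
  have := wl_le (S := S) ([] : List Γ) (by simp)
  simpa using this

theorem wl_mul {S : Set Γ} (hS : IsGenSet S) (g h : Γ) : wl S (g * h) ≤ wl S g + wl S h := by
  obtain ⟨a, ha, ha', rfl⟩ := wl_spec hS g
  obtain ⟨b, hb, hb', rfl⟩ := wl_spec hS h
  rw [← ha, ← hb, ← List.prod_append, ← List.length_append]
  apply wl_le
  intro x hx
  rcases List.mem_append.1 hx with h | h
  · exact ha' x h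
  · exact hb' x h

theorem wl_inv_le {S : Set Γ} (hS : IsGenSet S) (g : Γ) : wl S g⁻¹ ≤ wl S g := by
  obtain ⟨a, ha, ha', rfl⟩ := wl_spec hS g
  rw [← ha, List.prod_inv_reverse]
  refine (wl_le _ ?_).trans (by simp)
  intro x hx
  simp only [List.mem_reverse, List.mem_map] at hx
  obtain ⟨y, hy, rfl⟩ := hx
  exact hS.2.1 y (ha' y hy)

theorem wl_inv {S : Set Γ} (hS : IsGenSet S) (g : Γ) : wl S g⁻¹ = wl S g :=
  le_antisymm (wl_inv_le hS g) (by simpa using wl_inv_le hS g⁻¹)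

theorem wdist_comm {S : Set Γ} (hS : IsGenSet S) (x y : Γ) : wdist S x y = wdist S y x := by
  unfold wdist; rw [← wl_inv hS]; simp

theorem wdist_tri {S : Set Γ} (hS : IsGenSet S) (x y z : Γ) :
    wdist S x z ≤ wdist S x y + wdist S y z := by
  unfold wdist
  have := wl_mul hS (x⁻¹ * y) (y⁻¹ * z)
  simpa [mul_assoc] using this

theorem wl_finite {S : Set Γ} (hS : IsGenSet S) (n : ℕ) : {g : Γ | wl S g ≤ n}.Finite := by
  have hf : ∀ n : ℕ, {g : Γ | ∃ w : List Γ, w.length = n ∧ (∀ x ∈ w, x ∈ S) ∧ w.prod = g}.Finite := by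
    intro n
    have : {w : List Γ | w.length = n ∧ (∀ x ∈ w, x ∈ S)}.Finite := by
      have := hS.1.to_subtype
      refine ((List.finite_length_eq S n).image (List.map Subtype.val)).subset ?_
      rintro w ⟨h1, h2⟩
      refine ⟨w.attach.map (fun x => ⟨x.1, h2 x.1 x.2⟩), by simpa using h1, ?_⟩
      simp [List.map_map, Function.comp_def]
    refine (this.image List.prod).subset ?_
    rintro g ⟨w, h1, h2, h3⟩
    exact ⟨w, ⟨h1, h2⟩, h3⟩
  have h2 : {g : Γ | wl S g ≤ n} ⊆ ⋃ k ∈ Set.Iic n,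
      {g : Γ | ∃ w : List Γ, w.length = k ∧ (∀ x ∈ w, x ∈ S) ∧ w.prod = g} := by
    intro g hg
    simp only [Set.mem_iUnion]
    exact ⟨wl S g, hg, wl_spec hS g⟩
  exact ((Set.finite_Iic n).biUnion (fun k _ => hf k)).subset h2

theorem wl_step {S : Set Γ} (hS : IsGenSet S) (g : Γ) (n : ℕ) (h : wl S g = n + 1) :
    ∃ g' s, s ∈ S ∧ g = g' * s ∧ wl S g' = n := by
  obtain ⟨w, h1, h2, h3⟩ := wl_spec hS g
  have hne : w ≠ [] := by rintro rfl; simp at h1; omega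
  obtain ⟨w', s, rfl⟩ := List.eq_nil_or_concat' w |>.resolve_left hne
  have hw' : ∀ x ∈ w', x ∈ S := fun x hx => h2 x (by simp [hx])
  have hs : s ∈ S := h2 s (by simp)
  refine ⟨w'.prod, s, hs, by rw [← h3]; simp, ?_⟩
  have a1 := wl_le w' hw'
  have a2 := wl_le [s] (by simpa using hs)
  have a3 := wl_mul hS w'.prod s
  simp at a2 h1 h3
  rw [h3] at a3
  omega

theorem wl_geo {S : Set Γ} (hS : IsGenSet S) : ∀ (n : ℕ) (g : Γ), wl S g = n → ∃ α : ℕ → Γ,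
    α 0 = 1 ∧ α n = g ∧ ∀ i j, i ≤ j → j ≤ n → wdist S (α i) (α j) = j - i := by
  intro n
  induction n with
  | zero =>
    intro g hg
    obtain ⟨w, h1, h2, h3⟩ := wl_spec hS g
    rw [hg] at h1
    have : w = [] := List.length_eq_zero_iff.1 h1
    subst this
    refine ⟨fun _ => 1, rfl, by simpa using h3, ?_⟩
    intro i j hi hj
    simp [wdist, wl_one]; omega
  | succ n ih =>
    intro g hg
    obtain ⟨g', s, hs, rfl, h⟩ := wl_step hS g n hg
    obtain ⟨α, h0, h1, h2⟩ := ih g' h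
    refine ⟨fun i => if i ≤ n then α i else g' * s, by simp [h0], by simp, ?_⟩
    intro i j hij hj
    by_cases hjn : j ≤ n
    · simp only [hjn, hij.trans hjn, if_true]; exact h2 i j hij hjn
    · have : j = n + 1 := by omega
      subst this
      by_cases hin : i ≤ n
      · simp only [hin, if_true, hjn, if_false]
        have e1 := h2 i n hin le_rfl
        have e2 := h2 0 i (by omega) hin
        have e3 : wdist S g' (g' * s) ≤ 1 := by
          unfold wdist
          have := wl_le [s] (S := S) (by simpa using hs)
          simpa using this
        have e4 := wdist_tri hS (α i) g' (g' * s)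
        have e5 := wdist_tri hS 1 (α i) (g' * s)
        have e6 : wdist S 1 (g' * s) = n + 1 := by unfold wdist; simpa using hg
        rw [h1] at e1; rw [h0] at e2
        omega
      · have : i = n + 1 := by omega
        subst this
        simp [wdist, wl_one]

theorem hypMetric {S : Set Γ} (hS : IsGenSet S) {δ : ℝ} (hδ : IsHyperbolic S δ) :
    HypMetric (wdist S) (⌈δ⌉₊ + 1) where
  self x := by simp [wdist, wl_one]
  comm := wdist_comm hS
  tri := wdist_tri hS
  eq x y h := by
    obtain ⟨w, h1, h2, h3⟩ := wl_spec hS (x⁻¹ * y)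
    unfold wdist at h
    rw [h] at h1
    have : w = [] := List.length_eq_zero_iff.1 h1
    subst this
    simp at h3
    exact inv_mul_eq_one.1 h3.symm
  inv g x y := by simp [wdist, mul_assoc]
  hyp x y z w := by
    have inv : ∀ x y, wdist S (w⁻¹ * x) (w⁻¹ * y) = wdist S x y := by
      intro x y; simp [wdist, mul_assoc]
    have inv1 : ∀ x, wdist S (w⁻¹ * x) 1 = wdist S x w := by
      intro x; simp [wdist, mul_assoc]
    have h := hδ.2 (w⁻¹ * x) (w⁻¹ * y) (w⁻¹ * z)
    simp only [gp, inv, inv1] at h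
    have hc : δ ≤ (⌈δ⌉₊ : ℝ) := Nat.le_ceil δ
    rcases min_choice (((wdist S x w : ℝ) + (wdist S z w : ℝ) - (wdist S x z : ℝ)) / 2) (((wdist S y w : ℝ) + (wdist S z w : ℝ) - (wdist S y z : ℝ)) / 2) with e | e <;> rw [e] at h
    · left
      have : (wdist S x y + wdist S z w : ℝ) ≤ wdist S x z + wdist S y w + 2 * (⌈δ⌉₊ + 1) := by linarith
      exact_mod_cast this
    · right
      have : (wdist S x y + wdist S z w : ℝ) ≤ wdist S y z + wdist S x w + 2 * (⌈δ⌉₊ + 1) := by linarith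
      exact_mod_cast this
  geo x y := by
    obtain ⟨α, h0, h1, h2⟩ := wl_geo hS _ (x⁻¹ * y) rfl
    refine ⟨fun i => x * α i, by simp [h0], ?_, ?_⟩
    · show x * α (wl S (x⁻¹ * y)) = y
      rw [h1]; simp
    · intro i j hij hj
      rw [← h2 i j hij hj]
      simp [wdist, mul_assoc]
  fin n := by
    refine (wl_finite hS n).subset ?_
    intro g hg
    simpa [wdist] using hg

section
variable {d : Γ → Γ → ℕ} {δ : ℕ}

namespace HypMetric

theorem len_mul (H : HypMetric d δ) (g h : Γ) : d 1 (g * h) ≤ d 1 g + d 1 h := by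
  have h1 := H.tri 1 g (g * h)
  have h2 := H.inv g 1 h
  rw [mul_one] at h2
  omega

theorem len_inv (H : HypMetric d δ) (g : Γ) : d 1 g⁻¹ = d 1 g := by
  have := H.inv g 1 g⁻¹
  simp at this
  rw [← this, H.comm]

theorem dist_eq (H : HypMetric d δ) (x y : Γ) : d x y = d 1 (x⁻¹ * y) := by
  have := H.inv x⁻¹ x y
  simp at this
  exact this.symm

theorem dist_mul (H : HypMetric d δ) (x y : Γ) : d x (x * y) = d 1 y := by
  have := H.inv x 1 y
  simpa using this

/-- Point on a geodesic. -/
theorem pt (H : HypMetric d δ) (x y : Γ) (n : ℕ) (hn : n ≤ d x y) :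
    ∃ z, d x z = n ∧ d z y = d x y - n := by
  obtain ⟨α, h0, h1, h2⟩ := H.geo x y
  refine ⟨α n, ?_, ?_⟩
  · have := h2 0 n (by omega) hn
    rw [h0] at this; omega
  · have := h2 n _ hn le_rfl
    rw [h1] at this; omega

/-- Equal `(2δ+2)`-types give equal cones. -/
theorem cone_aux (H : HypMetric d δ) (g g' : Γ)
    (ht : ∀ h, d 1 h ≤ 2 * δ + 2 → d 1 (g' * h) < d 1 g' → d 1 (g * h) < d 1 g) :
    ∀ (n : ℕ) (h : Γ), d 1 h = n → d 1 (g * h) = d 1 g + d 1 h →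
      d 1 (g' * h) = d 1 g' + d 1 h := by
  intro n
  induction n with
  | zero =>
    intro h hh _
    have := H.eq _ _ hh
    subst this
    simp [H.self]
  | succ n ih =>
    intro h hh hg
    obtain ⟨h0, a1, a2⟩ := H.pt 1 h n (by omega)
    set s := h0⁻¹ * h with hs
    have e : h = h0 * s := by simp [hs]
    have ds : d 1 s = 1 := by rw [hs, ← H.dist_eq]; omega
    have b0 : d 1 (g * h0) = d 1 g + d 1 h0 := by
      have c1 := H.len_mul (g * h0) s
      have c2 := H.len_mul g h0
      rw [mul_assoc, ← e] at c1
      omega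
    have b1 := ih h0 a1 b0
    by_contra hcon
    have b2 := H.len_mul g' h
    have b3 : d 1 (g' * h0) ≤ d 1 (g' * h) + 1 := by
      have c1 := H.tri 1 (g' * h) (g' * h0)
      have c2 := H.inv g' h h0
      have c3 := H.comm h h0
      omega
    have b4 : 1 ≤ d 1 g' := by
      by_contra h0
      have := H.eq 1 g' (by omega)
      subst this
      apply hcon
      simp [H.self]
    obtain ⟨u, u1, u2⟩ := H.pt 1 (g' * h) (d 1 g' - 1) (by omega)
    have b5 : d g' (g' * h) = d 1 h := H.dist_mul _ _
    have b6 : d u g' ≤ 2 * δ + 2 := by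
      have := H.hyp u g' 1 (g' * h)
      have e1 := H.comm u 1
      have e2 := H.comm g' 1
      omega
    have c1 := ht (g'⁻¹ * u) (by rw [← H.dist_eq, H.comm]; exact b6)
      (by rw [mul_inv_cancel_left]; omega)
    have c2 := H.len_mul (g * (g'⁻¹ * u)) (u⁻¹ * (g' * h))
    rw [← H.dist_eq] at c2
    have c3 : g * (g'⁻¹ * u) * (u⁻¹ * (g' * h)) = g * h := by group
    rw [c3] at c2
    omega

theorem cone_mul (H : HypMetric d δ) (g g' v : Γ)
    (hc : ∀ h, d 1 (g * h) = d 1 g + d 1 h ↔ d 1 (g' * h) = d 1 g' + d 1 h)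
    (hv : d 1 (g * v) = d 1 g + d 1 v) :
    ∀ h, d 1 (g * v * h) = d 1 (g * v) + d 1 h ↔ d 1 (g' * v * h) = d 1 (g' * v) + d 1 h := by
  have aux : ∀ g g' : Γ, (∀ h, d 1 (g * h) = d 1 g + d 1 h ↔ d 1 (g' * h) = d 1 g' + d 1 h) →
    d 1 (g * v) = d 1 g + d 1 v → ∀ h, d 1 (g * v * h) = d 1 (g * v) + d 1 h →
      d 1 (g' * v * h) = d 1 (g' * v) + d 1 h := by
    intro g g' hc hv h hh
    have h1 := H.len_mul g (v * h)
    have h2 := H.len_mul v h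
    rw [← mul_assoc] at h1
    have h3 := (hc (v * h)).1 (by rw [← mul_assoc]; omega)
    have h4 := (hc v).1 hv
    rw [← mul_assoc] at h3
    omega
  intro h
  exact ⟨aux g g' hc hv h, aux g' g (fun h => (hc h).symm) ((hc v).1 hv) h⟩

theorem exists_long (H : HypMetric d δ) [Infinite Γ] (n : ℕ) : ∃ g, n < d 1 g := by
  by_contra hc
  push Not at hc
  exact Set.infinite_univ ((H.fin n).subset (fun g _ => hc g))

theorem exists_axis (H : HypMetric d δ) [Infinite Γ] :
    ∃ v : Γ, 0 < d 1 v ∧ ∀ n : ℕ, d 1 (v ^ n) = n * d 1 v := by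
  classical
  set Bf := (H.fin (2 * δ + 2)).toFinset with hB
  obtain ⟨g, hg⟩ := H.exists_long (Bf.powerset.card)
  obtain ⟨α, h0, h1, h2⟩ := H.geo 1 g
  obtain ⟨i, hi, j, hj, hij, hF⟩ := Finset.exists_ne_map_eq_of_card_lt_of_maps_to
    (s := Finset.range (d 1 g + 1)) (t := Bf.powerset)
    (f := fun i => Bf.filter (fun h => d 1 (α i * h) < d 1 (α i)))
    (by simp only [Finset.card_range]; omega)
    (fun i _ => Finset.mem_coe.2 (Finset.mem_powerset.2 (Finset.filter_subset _ _)))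
  wlog hlt : i < j generalizing i j
  · exact this j hj i hi hij.symm hF.symm (by omega)
  simp only [Finset.mem_range] at hi hj
  have htype : ∀ h, d 1 h ≤ 2 * δ + 2 → (d 1 (α i * h) < d 1 (α i) ↔ d 1 (α j * h) < d 1 (α j)) := by
    intro h hh
    have hm : h ∈ Bf := by simp [hB, hh]
    have := congrArg (fun F => h ∈ F) hF
    simpa [hm] using this
  have hcone : ∀ h, d 1 (α i * h) = d 1 (α i) + d 1 h ↔ d 1 (α j * h) = d 1 (α j) + d 1 h := by
    intro h
    exact ⟨H.cone_aux _ _ (fun h hh => (htype h hh).2) _ h rfl,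
      H.cone_aux _ _ (fun h hh => (htype h hh).1) _ h rfl⟩
  have e1 := h2 0 i (by omega) (by omega)
  have e2 := h2 0 j (by omega) (by omega)
  have e3 := h2 i j (by omega) (by omega)
  rw [h0] at e1 e2
  set v := (α i)⁻¹ * α j with hv
  have ev : α i * v = α j := by simp [hv]
  have lv : d 1 v = j - i := by rw [hv, ← H.dist_eq]; exact e3
  have hcv : d 1 (α i * v) = d 1 (α i) + d 1 v := by rw [ev]; omega
  have key : ∀ n : ℕ, d 1 (α i * v ^ n) = d 1 (α i) + n * d 1 v ∧
      ∀ h, d 1 (α i * h) = d 1 (α i) + d 1 h ↔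
        d 1 (α i * v ^ n * h) = d 1 (α i * v ^ n) + d 1 h := by
    intro n
    induction n with
    | zero => simp
    | succ n ih =>
      obtain ⟨k1, k2⟩ := ih
      have k3 := (k2 v).1 hcv
      constructor
      · rw [pow_succ, ← mul_assoc, k3, k1]; ring
      · intro h
        have e5 : α i * v ^ (n + 1) = α i * v ^ n * v := by rw [pow_succ, mul_assoc]
        rw [hcone h, ← ev, e5]
        exact H.cone_mul (α i) (α i * v ^ n) v k2 hcv h
  refine ⟨v, by omega, fun n => ?_⟩
  have k1 := (key n).1
  have k2 := H.len_mul (α i) (v ^ n)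
  have k3 : d 1 (v ^ n) ≤ n * d 1 v := by
    clear k1 k2
    induction n with
    | zero => simp [H.self]
    | succ n ih =>
      rw [pow_succ]
      refine (H.len_mul _ _).trans ?_
      rw [Nat.succ_mul]; omega
  omega

theorem zpow_dist (H : HypMetric d δ) {v : Γ} (hv : ∀ n : ℕ, d 1 (v ^ n) = n * d 1 v) (i j : ℤ) :
    d (v ^ i) (v ^ j) = (j - i).natAbs * d 1 v := by
  rw [H.dist_eq, ← zpow_neg, ← zpow_add, ← hv]
  have : -i + j = j - i := by ring
  rw [this]
  rcases Int.natAbs_eq (j - i) with h | h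
  · conv_lhs => rw [h]
    rw [zpow_natCast]
  · conv_lhs => rw [h]
    rw [zpow_neg, zpow_natCast, H.len_inv]

theorem swap (H : HypMetric d δ) (X X' Z a : Γ) (K l : ℕ) (h1 : d X a + d a Z ≤ d X Z + K)
    (h2 : d X X' ≤ l) (h3 : 2 * l + 2 * δ + K < 2 * d X a) :
    d X' a + d a Z ≤ d X' Z + K + 2 * δ := by
  have h4 := H.hyp a X' X Z
  have h5 := H.tri X X' a
  have h6 := H.comm a X'
  have h7 := H.comm a X
  have h8 := H.comm X' X
  omega

/-- points almost between two points of an axis are near the axis. -/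
theorem near (H : HypMetric d δ) {v : Γ} (h0 : 0 < d 1 v)
    (hv : ∀ n : ℕ, d 1 (v ^ n) = n * d 1 v) (a : Γ) (j : ℤ) (K : ℕ)
    (h : d 1 a + d a (v ^ j) ≤ d 1 (v ^ j) + K) : ∃ m : ℤ, d a (v ^ m) ≤ K + d 1 v + 2 * δ := by
  have hz : ∀ j : ℤ, d 1 (v ^ j) = j.natAbs * d 1 v := by
    intro j; have := H.zpow_dist hv 0 j; simpa using this
  have main : ∀ m : ℤ, d 1 (v ^ m) + d (v ^ m) (v ^ j) = d 1 (v ^ j) → d 1 (v ^ m) ≤ d 1 a →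
      d 1 a ≤ d 1 (v ^ m) + d 1 v + K → d a (v ^ m) ≤ K + d 1 v + 2 * δ := by
    intro m h1 h2 h3
    have h4 := H.hyp a (v ^ m) 1 (v ^ j)
    have h5 := H.comm a 1
    have h6 := H.comm (v ^ m) 1
    omega
  have hq1 := Nat.div_mul_le_self (d 1 a) (d 1 v)
  have hq2 : d 1 a < (d 1 a / d 1 v) * d 1 v + d 1 v := by
    have := Nat.lt_div_mul_add h0 (a := d 1 a); omega
  generalize d 1 a / d 1 v = q at hq1 hq2
  by_cases hqj : q ≤ j.natAbs
  · have : ∃ m : ℤ, m.natAbs = q ∧ (j - m).natAbs = j.natAbs - q := by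
      rcases le_total 0 j with hj | hj
      · exact ⟨(q : ℤ), by simp, by omega⟩
      · exact ⟨-(q : ℤ), by simp, by omega⟩
    obtain ⟨m, hm1, hm2⟩ := this
    refine ⟨m, main m ?_ ?_ ?_⟩
    · rw [hz, hz, H.zpow_dist hv, hm1, hm2, ← add_mul]; congr 1; omega
    · rw [hz, hm1]; exact hq1
    · rw [hz, hm1]; omega
  · refine ⟨j, main j ?_ ?_ ?_⟩
    · rw [H.self]; rfl
    · rw [hz]
      exact (Nat.mul_le_mul_right _ (by omega : j.natAbs ≤ q)).trans hq1
    · omega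

theorem finite_of_near (H : HypMetric d δ) (hne : Nonelementary Γ) (v : Γ) (C : ℕ)
    (h : ∀ g : Γ, ∃ m : ℤ, d g (v ^ m) ≤ C) : False := by
  have hfin : Finite (Γ ⧸ Subgroup.zpowers v) := by
    have h1 := (H.fin C).image (fun g : Γ => (g : Γ ⧸ Subgroup.zpowers v))
    refine Set.finite_univ_iff.1 (h1.subset ?_)
    intro x _
    obtain ⟨g, rfl⟩ := QuotientGroup.mk_surjective x
    obtain ⟨m, hm⟩ := h g⁻¹
    refine ⟨g * v ^ m, ?_, ?_⟩
    · have := H.dist_eq g⁻¹ (v ^ m)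
      simp at this
      simp; omega
    · refine QuotientGroup.eq.2 ?_
      refine ⟨-m, ?_⟩
      simp
  have := Subgroup.finiteIndex_of_finite_quotient (H := Subgroup.zpowers v)
  exact this.index_ne_zero (hne v)

end HypMetric

end

section
variable {d : Γ → Γ → ℕ} {δ : ℕ}

namespace HypMetric

theorem fellow (H : HypMetric d δ) {v : Γ} (h0 : 0 < d 1 v)
    (hv : ∀ n : ℕ, d 1 (v ^ n) = n * d 1 v) (g : Γ) (i j e : ℤ) (n c : ℕ)
    (hc : d (g * v ^ i) (v ^ j) + c < (i.natAbs + j.natAbs) * d 1 v)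
    (hn : d 1 g + δ + 1 ≤ n) (hcn : 3 * d 1 g + 2 * (n * d 1 v) + 2 * δ ≤ c)
    (he : e.natAbs = n) (hei : (i - e).natAbs + n = i.natAbs) :
    ∃ m : ℤ, d (g * v ^ e) (v ^ m) ≤ 4 * δ + d 1 v + 2 * δ := by
  have hz : ∀ j : ℤ, d 1 (v ^ j) = j.natAbs * d 1 v := by
    intro j; have := H.zpow_dist hv 0 j; simpa using this
  have a1 : d g (g * v ^ e) = n * d 1 v := by rw [H.dist_mul, hz, he]
  have a2 : d (g * v ^ e) (g * v ^ i) = (i - e).natAbs * d 1 v := by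
    rw [H.inv, H.zpow_dist hv]
  have a3 : d g (g * v ^ i) = i.natAbs * d 1 v := by rw [H.dist_mul, hz]
  have a4 : (i - e).natAbs * d 1 v + n * d 1 v = i.natAbs * d 1 v := by rw [← add_mul, hei]
  have a5 : n ≤ n * d 1 v := Nat.le_mul_of_pos_right _ h0
  have a6 := hz j
  rw [add_mul] at hc
  have key : d 1 (g * v ^ e) + d (g * v ^ e) (v ^ j) ≤ d 1 (v ^ j) + 4 * δ := by
    have b1 := H.swap g 1 (g * v ^ i) (g * v ^ e) 0 (d 1 g) (by omega) (by rw [H.comm]) (by omega)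
    have b2 := H.hyp (g * v ^ e) (v ^ j) 1 (g * v ^ i)
    have b3 := H.tri g 1 (g * v ^ i)
    have b4 := H.comm g 1
    have b5 := H.comm (g * v ^ e) 1
    have b6 := H.comm (v ^ j) 1
    have b7 := H.comm (g * v ^ i) (v ^ j)
    have b8 := H.tri 1 (g * v ^ e) (v ^ j)
    have b9 := H.tri 1 g (g * v ^ e)
    omega
  exact H.near h0 hv _ j _ key

theorem commensurate (H : HypMetric d δ) {v : Γ} (h0 : 0 < d 1 v)
    (hv : ∀ n : ℕ, d 1 (v ^ n) = n * d 1 v) (g : Γ)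
    (hg : ∀ c : ℕ, ∃ i j : ℤ, d (g * v ^ i) (v ^ j) + c < (i.natAbs + j.natAbs) * d 1 v) :
    ∃ q r : ℤ, q ≠ 0 ∧ g * v ^ q = v ^ r * g := by
  classical
  set Bf := (H.fin (4 * δ + d 1 v + 2 * δ)).toFinset with hB
  set n1 := d 1 g + δ + 1 with hn1
  obtain ⟨i, j, hc⟩ := hg (3 * d 1 g + 2 * ((n1 + Bf.card) * d 1 v) + 2 * δ)
  have hz : ∀ j : ℤ, d 1 (v ^ j) = j.natAbs * d 1 v := by
    intro j; have := H.zpow_dist hv 0 j; simpa using this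
  have hi : n1 + Bf.card ≤ i.natAbs := by
    have c1 := H.tri 1 (g * v ^ i) (v ^ j)
    have c2 := H.len_mul g (v ^ i)
    rw [hz] at c1 c2
    rw [add_mul i.natAbs] at hc
    have : (n1 + Bf.card) * d 1 v ≤ i.natAbs * d 1 v := by omega
    exact Nat.le_of_mul_le_mul_right this h0
  set e : ℕ → ℤ := fun n => if 0 ≤ i then (n : ℤ) else -(n : ℤ) with he
  have hnear : ∀ n ∈ Finset.range (Bf.card + 1),
      ∃ m : ℤ, d (g * v ^ (e (n1 + n))) (v ^ m) ≤ 4 * δ + d 1 v + 2 * δ := by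
    intro n hn
    simp only [Finset.mem_range] at hn
    refine H.fellow h0 hv g i j (e (n1 + n)) (n1 + n) _ hc (by omega) ?_ ?_ ?_
    · have : (n1 + n) * d 1 v ≤ (n1 + Bf.card) * d 1 v := Nat.mul_le_mul_right _ (by omega)
      omega
    · simp only [he]; split_ifs <;> omega
    · simp only [he]; split_ifs <;> omega
  choose! m hm using hnear
  obtain ⟨a, ha, b, hb, hab, hF⟩ := Finset.exists_ne_map_eq_of_card_lt_of_maps_to
    (s := Finset.range (Bf.card + 1)) (t := Bf)
    (f := fun n => (v ^ m n)⁻¹ * (g * v ^ (e (n1 + n))))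
    (by simp)
    (fun n hn => by
      have := hm n hn
      rw [H.comm, H.dist_eq] at this
      simpa [hB] using this)
  refine ⟨e (n1 + b) - e (n1 + a), m b - m a, ?_, ?_⟩
  · simp only [he]; split_ifs <;> omega
  · have h1 : g * v ^ (e (n1 + b)) = v ^ m b * (v ^ m a)⁻¹ * (g * v ^ (e (n1 + a))) := by
      rw [mul_assoc, hF]; group
    rw [zpow_sub, zpow_sub, ← mul_assoc, h1]
    group

theorem near_of_comm (H : HypMetric d δ) {v : Γ} (h0 : 0 < d 1 v)
    (hv : ∀ n : ℕ, d 1 (v ^ n) = n * d 1 v) (g : Γ) (q r : ℤ) (hq : q ≠ 0)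
    (h : g * v ^ q = v ^ r * g) : ∃ m : ℤ, d g (v ^ m) ≤ 4 * δ + d 1 v + 2 * δ := by
  have hz : ∀ j : ℤ, d 1 (v ^ j) = j.natAbs * d 1 v := by
    intro j; have := H.zpow_dist hv 0 j; simpa using this
  have hk : ∀ k : ℤ, g * v ^ (q * k) = v ^ (r * k) * g := by
    intro k
    have h1 : g * v ^ q * g⁻¹ = v ^ r := by rw [h]; group
    have h2 := conj_zpow (a := g) (b := v ^ q) (i := k)
    rw [h1] at h2
    rw [zpow_mul, zpow_mul, h2]; group
  obtain ⟨k, hkk⟩ : ∃ k : ℕ, k = d 1 g + 2 * δ + 1 := ⟨_, rfl⟩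
  have hA := hk (-k)
  have hB := hk k
  have b1 : d g (g * v ^ (q * (-k : ℤ))) = q.natAbs * k * d 1 v := by
    rw [H.dist_mul, hz, Int.natAbs_mul]; simp
  have b2 : d g (g * v ^ (q * (k : ℤ))) = q.natAbs * k * d 1 v := by
    rw [H.dist_mul, hz, Int.natAbs_mul]; simp
  have b3 : d (g * v ^ (q * (-k : ℤ))) (g * v ^ (q * (k : ℤ))) = 2 * (q.natAbs * k * d 1 v) := by
    rw [H.inv, H.zpow_dist hv]
    have : q * (k : ℤ) - q * (-k : ℤ) = 2 * (q * k) := by ring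
    rw [this, Int.natAbs_mul, Int.natAbs_mul]; simp; ring
  have b4 : k ≤ q.natAbs * k * d 1 v := by
    have h1 : 1 ≤ q.natAbs := by omega
    calc k = 1 * k * 1 := by ring
      _ ≤ _ := Nat.mul_le_mul (Nat.mul_le_mul_right _ h1) h0
  have b5 : d (v ^ (r * (-k : ℤ))) (g * v ^ (q * (-k : ℤ))) = d 1 g := by
    rw [hA, H.dist_mul]
  have b6 : d (v ^ (r * (k : ℤ))) (g * v ^ (q * (k : ℤ))) = d 1 g := by
    rw [hB, H.dist_mul]
  set A' := g * v ^ (q * (-k : ℤ))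
  set B' := g * v ^ (q * (k : ℤ))
  have c1 := H.swap A' (v ^ (r * (-k : ℤ))) B' g 0 (d 1 g)
    (by rw [H.comm A' g]; omega) (by rw [H.comm]; omega) (by rw [H.comm A' g]; omega)
  have c2 := H.swap B' (v ^ (r * (k : ℤ))) (v ^ (r * (-k : ℤ))) g (2 * δ) (d 1 g)
    (by rw [H.comm B' g, H.comm g (v ^ (r * (-k : ℤ))), H.comm B' (v ^ (r * (-k : ℤ)))]; omega)
    (by rw [H.comm]; omega) (by rw [H.comm B' g]; omega)
  -- translate
  have d1 : d 1 ((v ^ (r * (-k : ℤ)))⁻¹ * g) = d (v ^ (r * (-k : ℤ))) g := (H.dist_eq _ _).symm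
  have d2 : ∀ x, d ((v ^ (r * (-k : ℤ)))⁻¹ * g) ((v ^ (r * (-k : ℤ)))⁻¹ * x) = d g x :=
    fun x => H.inv _ _ _
  have d3 : (v ^ (r * (-k : ℤ)))⁻¹ * v ^ (r * (k : ℤ)) = v ^ (2 * r * k) := by
    rw [← zpow_neg, ← zpow_add]; congr 1; ring
  have d4 : d 1 (v ^ (2 * r * k)) = d (v ^ (r * (-k : ℤ))) (v ^ (r * (k : ℤ))) := by
    rw [← d3, ← H.dist_eq]
  obtain ⟨m, hm⟩ := H.near h0 hv ((v ^ (r * (-k : ℤ)))⁻¹ * g) (2 * r * k) (4 * δ) (by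
    rw [d1, d4, ← d3, d2]
    rw [H.comm (v ^ (r * (k : ℤ))) g, H.comm (v ^ (r * (k : ℤ))) (v ^ (r * (-k : ℤ))),
      H.comm g (v ^ (r * (-k : ℤ)))] at c2
    omega)
  refine ⟨r * (-k : ℤ) + m, ?_⟩
  rw [← d2, zpow_add, inv_mul_cancel_left]
  exact hm

theorem exists_indep (H : HypMetric d δ) (hne : Nonelementary Γ) {v : Γ} (h0 : 0 < d 1 v)
    (hv : ∀ n : ℕ, d 1 (v ^ n) = n * d 1 v) :
    ∃ (g : Γ) (c : ℕ), ∀ i j : ℤ, (i.natAbs + j.natAbs) * d 1 v ≤ d (g * v ^ i) (v ^ j) + c := by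
  by_contra hcon
  push Not at hcon
  refine H.finite_of_near hne v (4 * δ + d 1 v + 2 * δ) (fun g => ?_)
  obtain ⟨q, r, hq, h⟩ := H.commensurate h0 hv g (hcon g)
  exact H.near_of_comm h0 hv g q r hq h

theorem four_pts (H : HypMetric d δ) (L c l : ℕ) (b1 b2 b3 b4 z : Γ)
    (hl : ∀ b, b = b1 ∨ b = b2 ∨ b = b3 ∨ b = b4 → d 1 b ≤ L + l)
    (h12 : 2 * L ≤ d b1 b2 + c) (h13 : 2 * L ≤ d b1 b3 + c) (h14 : 2 * L ≤ d b1 b4 + c)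
    (h23 : 2 * L ≤ d b2 b3 + c) (h24 : 2 * L ≤ d b2 b4 + c) (h34 : 2 * L ≤ d b3 b4 + c)
    (hL : 3 * (c + l + 2 * δ) + l + 1 ≤ 2 * L) :
    4 * d 1 z + 1 ≤ d z b1 + d z b2 + d z b3 + d z b4 := by
  have l1 := hl b1 (by simp)
  have l2 := hl b2 (by simp)
  have l3 := hl b3 (by simp)
  have l4 := hl b4 (by simp)
  have key : ∀ b b', d 1 b ≤ L + l → d 1 b' ≤ L + l → 2 * L ≤ d b b' + c →
      d 1 z + L ≤ d z b + (c + l + 2 * δ) ∨ d 1 z + L ≤ d z b' + (c + l + 2 * δ) := by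
    intro b b' h1 h2 h3
    have := H.hyp b b' z 1
    have e1 := H.comm b z
    have e2 := H.comm b' z
    have e3 := H.comm b' 1
    have e4 := H.comm b 1
    have e5 := H.comm z 1
    omega
  have k12 := key _ _ l1 l2 h12
  have k13 := key _ _ l1 l3 h13
  have k14 := key _ _ l1 l4 h14
  have k23 := key _ _ l2 l3 h23
  have k24 := key _ _ l2 l4 h24
  have k34 := key _ _ l3 l4 h34
  have t : ∀ b, d 1 b ≤ L + l → d 1 z ≤ d z b + (L + l) := by
    intro b hb
    have := H.tri 1 b z
    have e1 := H.comm b z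
    omega
  have t1 := t _ l1
  have t2 := t _ l2
  have t3 := t _ l3
  have t4 := t _ l4
  clear key t hl
  rcases k12 with k | k <;> rcases k34 with k' | k' <;> omega

theorem exists_pair (H : HypMetric d δ) (hne : Nonelementary Γ) :
    ∃ v t : Γ, ∀ x, 4 * d 1 x + 1 ≤ d 1 (x * v) + d 1 (x * v⁻¹) + d 1 (x * t) + d 1 (x * t⁻¹) := by
  have hinf : Infinite Γ := by
    by_contra hfin
    rw [not_infinite_iff_finite] at hfin
    exact (Subgroup.index_ne_zero_of_finite (H := Subgroup.zpowers (1 : Γ))) (hne 1)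
  obtain ⟨v, h0, hv⟩ := H.exists_axis
  obtain ⟨g, c, hg⟩ := H.exists_indep hne h0 hv
  obtain ⟨N, hN⟩ : ∃ N : ℕ, N = 3 * ((c + 2 * d 1 g) + 2 * d 1 g + 2 * δ) + 2 * d 1 g + 1 :=
    ⟨_, rfl⟩
  have hz : ∀ j : ℤ, d 1 (v ^ j) = j.natAbs * d 1 v := by
    intro j; have := H.zpow_dist hv 0 j; simpa using this
  have hLN : N ≤ N * d 1 v := Nat.le_mul_of_pos_right _ h0
  have ht : ∀ i j : ℤ, i.natAbs = N → j.natAbs = N →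
      2 * (N * d 1 v) ≤ d (g * v ^ i * g⁻¹) (v ^ j) + (c + 2 * d 1 g) := by
    intro i j hi hj
    have h1 := hg i j
    have h2 := H.tri (g * v ^ i) (g * v ^ i * g⁻¹) (v ^ j)
    rw [H.dist_mul, H.len_inv] at h2
    rw [hi, hj, add_mul] at h1
    omega
  have hlt : ∀ i : ℤ, i.natAbs = N → d 1 (g * v ^ i * g⁻¹) ≤ N * d 1 v + 2 * d 1 g := by
    intro i hi
    have h1 := H.len_mul (g * v ^ i) g⁻¹
    have h2 := H.len_mul g (v ^ i)
    rw [hz, hi] at h2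
    rw [H.len_inv] at h1
    omega
  refine ⟨v ^ (N : ℤ), g * v ^ (N : ℤ) * g⁻¹, fun x => ?_⟩
  have hinv : (g * v ^ (N : ℤ) * g⁻¹)⁻¹ = g * v ^ (-(N : ℤ)) * g⁻¹ := by group
  rw [hinv, ← zpow_neg]
  have hx : ∀ b, d 1 (x * b) = d x⁻¹ b := by
    intro b; rw [H.dist_eq x⁻¹]; simp
  rw [hx, hx, hx, hx, ← H.len_inv x]
  refine H.four_pts (N * d 1 v) (c + 2 * d 1 g) (2 * d 1 g) _ _ _ _ _ ?_ ?_ ?_ ?_ ?_ ?_ ?_ ?_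
  · rintro b (rfl | rfl | rfl | rfl)
    · rw [hz]; simp
    · rw [hz]; simp
    · exact hlt _ (by simp)
    · exact hlt _ (by simp)
  · rw [H.zpow_dist hv]
    have : (-(N : ℤ) - N).natAbs = 2 * N := by omega
    rw [this, mul_assoc]; omega
  · rw [H.comm (v ^ _)]; exact ht (N : ℤ) (N : ℤ) (by simp) (by simp)
  · rw [H.comm (v ^ _)]; exact ht (-(N : ℤ)) (N : ℤ) (by simp) (by simp)
  · rw [H.comm (v ^ _)]; exact ht (N : ℤ) (-(N : ℤ)) (by simp) (by simp)
  · rw [H.comm (v ^ _)]; exact ht (-(N : ℤ)) (-(N : ℤ)) (by simp) (by simp)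
  · have h1 : d 1 (v ^ (-(2 * N : ℤ))) = 2 * (N * d 1 v) := by
      rw [hz]
      have : (-(2 * N : ℤ)).natAbs = 2 * N := by omega
      rw [this, mul_assoc]
    have h2 : d (g * v ^ (N : ℤ) * g⁻¹) (g * v ^ (-(N : ℤ)) * g⁻¹) =
        d 1 (g * v ^ (-(2 * N : ℤ)) * g⁻¹) := by
      rw [H.dist_eq]; congr 1; group
    have h3 : v ^ (-(2 * N : ℤ)) = g⁻¹ * (g * v ^ (-(2 * N : ℤ)) * g⁻¹) * g := by group
    have h4 := H.len_mul (g⁻¹ * (g * v ^ (-(2 * N : ℤ)) * g⁻¹)) g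
    have h5 := H.len_mul g⁻¹ (g * v ^ (-(2 * N : ℤ)) * g⁻¹)
    rw [← h3] at h4
    rw [H.len_inv] at h5
    omega
  · omega

end HypMetric

end

/-- Square summable functions. -/
abbrev L2 (Γ : Type) : Type := ↥(lp (fun _ : Γ => ℝ) 2)

theorem l2_memlp {f : Γ → ℝ} : Memℓp f 2 ↔ Summable fun x => f x ^ 2 := by
  rw [memℓp_gen_iff (by norm_num)]
  simp

theorem l2_hasSum (f : L2 Γ) : HasSum (fun x => f x ^ 2) (‖f‖ ^ 2) := by
  have := lp.hasSum_norm (p := 2) (by norm_num) f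
  simpa using this

theorem l2_norm_mono {f g : L2 Γ} (h : ∀ x, |f x| ≤ |g x|) : ‖f‖ ≤ ‖g‖ := by
  have h1 := hasSum_le (fun x => sq_le_sq.2 (h x)) (l2_hasSum f) (l2_hasSum g)
  exact (sq_le_sq₀ (norm_nonneg _) (norm_nonneg _)).1 h1

theorem l2_apply_le (f : L2 Γ) (x : Γ) : |f x| ≤ ‖f‖ :=
  lp.norm_apply_le_norm (by norm_num) f x

theorem l2_ext {f g : L2 Γ} (h : ∀ x, f x = g x) : f = g :=
  lp.ext (funext h)

@[simp] theorem l2_add (f g : L2 Γ) (x : Γ) : (f + g) x = f x + g x := rfl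
@[simp] theorem l2_sub (f g : L2 Γ) (x : Γ) : (f - g) x = f x - g x := rfl
@[simp] theorem l2_smul (c : ℝ) (f : L2 Γ) (x : Γ) : (c • f) x = c * f x := rfl
@[simp] theorem l2_zero (x : Γ) : (0 : L2 Γ) x = 0 := rfl

theorem l2_sum {ι : Type*} (s : Finset ι) (f : ι → L2 Γ) (x : Γ) :
    (∑ i ∈ s, f i) x = ∑ i ∈ s, f i x := by
  rw [lp.coeFn_sum]; simp

/-- Constructor. -/
def l2mk (f : Γ → ℝ) (h : Summable fun x => f x ^ 2) : L2 Γ := ⟨f, l2_memlp.2 h⟩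

@[simp] theorem l2mk_apply (f : Γ → ℝ) (h : Summable fun x => f x ^ 2) (x : Γ) :
    l2mk f h x = f x := rfl

theorem l2_shift_hasSum (f : L2 Γ) (s : Γ) :
    HasSum (fun x => f (x * s) ^ 2) (‖f‖ ^ 2) :=
  (Equiv.mulRight s).hasSum_iff.2 (l2_hasSum f)

/-- Right translation. -/
noncomputable def RT (s : Γ) : L2 Γ →L[ℝ] L2 Γ :=
  LinearMap.mkContinuous
    { toFun := fun f => l2mk (fun x => f (x * s)) (l2_shift_hasSum f s).summable
      map_add' := fun f g => rfl
      map_smul' := fun c f => rfl } 1 (fun f => by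
        rw [one_mul]
        refine le_of_eq ?_
        have h1 := (l2_hasSum (l2mk (fun x => f (x * s)) (l2_shift_hasSum f s).summable)).unique
          (l2_shift_hasSum f s)
        exact (sq_eq_sq₀ (norm_nonneg _) (norm_nonneg _)).1 h1)

@[simp] theorem RT_apply (s : Γ) (f : L2 Γ) (x : Γ) : RT s f x = f (x * s) := rfl

theorem RT_norm (s : Γ) (f : L2 Γ) : ‖RT s f‖ = ‖f‖ := by
  have h1 := (l2_hasSum (RT s f)).unique (l2_shift_hasSum f s)
  exact (sq_eq_sq₀ (norm_nonneg _) (norm_nonneg _)).1 h1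

theorem RT_one : RT (1 : Γ) = 1 := by
  ext1 f; apply l2_ext; intro x; simp

theorem RT_mul (a b : Γ) : RT (a * b) = RT a * RT b := by
  ext1 f; apply l2_ext; intro x; simp [mul_assoc]

/-- `f² h`-type estimate. -/
theorem HypMetric.pair_est {d : Γ → Γ → ℕ} {δ : ℕ} (H : HypMetric d δ) (f : L2 Γ) (b : Γ)
    (t : ℝ) (ht : 0 < t) :
    ∃ A A' : ℝ, HasSum (fun x => f x ^ 2 * ((d 1 (x * b) : ℝ) - d 1 x)) A ∧
      HasSum (fun x => f x ^ 2 * ((d 1 (x * b⁻¹) : ℝ) - d 1 x)) A' ∧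
      A + A' ≤ d 1 b * (t * ‖f - RT b f‖ ^ 2 + 4 * ‖f‖ ^ 2 / t) / 2 := by
  have hb : ∀ x b : Γ, |(d 1 (x * b) : ℝ) - d 1 x| ≤ d 1 b := by
    intro x b
    have h1 := H.len_mul x b
    have h2 := H.len_mul (x * b) b⁻¹
    rw [mul_inv_cancel_right, H.len_inv] at h2
    rw [abs_le]
    have h1' : (d 1 (x * b) : ℝ) ≤ d 1 x + d 1 b := by exact_mod_cast h1
    have h2' : (d 1 x : ℝ) ≤ d 1 (x * b) + d 1 b := by exact_mod_cast h2
    constructor <;> linarith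
  have hs : ∀ b : Γ, Summable (fun x => f x ^ 2 * ((d 1 (x * b) : ℝ) - d 1 x)) := by
    intro b
    refine Summable.of_norm_bounded ((l2_hasSum f).summable.mul_right (d 1 b : ℝ)) ?_
    intro x
    rw [norm_mul, Real.norm_of_nonneg (sq_nonneg _)]
    exact mul_le_mul_of_nonneg_left (hb x b) (sq_nonneg _)
  obtain ⟨A, hA⟩ := hs b
  obtain ⟨A', hA'⟩ := hs b⁻¹
  refine ⟨A, A', hA, hA', ?_⟩
  have h2 := (Equiv.mulRight b).hasSum_iff.2 hA'
  have h3 := hA.add h2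
  have h4 := (((l2_hasSum (f - RT b f)).mul_left t).add
    ((l2_hasSum (f + RT b f)).mul_left t⁻¹)).mul_left ((d 1 b : ℝ) / 2)
  have h5 := hasSum_le (fun x => ?_) h3 h4
  · refine h5.trans ?_
    have h6 : ‖f + RT b f‖ ^ 2 ≤ 4 * ‖f‖ ^ 2 := by
      have := norm_add_le f (RT b f)
      rw [RT_norm] at this
      nlinarith [norm_nonneg (f + RT b f)]
    have h7 : t⁻¹ * ‖f + RT b f‖ ^ 2 ≤ 4 * ‖f‖ ^ 2 / t := by
      rw [div_eq_inv_mul]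
      exact mul_le_mul_of_nonneg_left h6 (inv_pos.2 ht).le
    have h8 : (0 : ℝ) ≤ (d 1 b : ℝ) / 2 := by positivity
    calc _ ≤ (d 1 b : ℝ) / 2 * (t * ‖f - RT b f‖ ^ 2 + 4 * ‖f‖ ^ 2 / t) := by gcongr
      _ = _ := by ring
  · simp only [Function.comp, Equiv.coe_mulRight, mul_inv_cancel_right, l2_sub, l2_add, RT_apply]
    have e : f x ^ 2 * ((d 1 (x * b) : ℝ) - d 1 x) + f (x * b) ^ 2 * ((d 1 x : ℝ) - d 1 (x * b))
      = ((f x - f (x * b)) * (f x + f (x * b))) * ((d 1 (x * b) : ℝ) - d 1 x) := by ring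
    rw [e]
    set p := f x - f (x * b)
    set q := f x + f (x * b)
    have h9 : |p * q| ≤ (t * p ^ 2 + t⁻¹ * q ^ 2) / 2 := by
      have e2 : t * p ^ 2 + t⁻¹ * q ^ 2 - 2 * |p * q| = t⁻¹ * (t * |p| - |q|) ^ 2 := by
        rw [abs_mul, ← sq_abs p, ← sq_abs q]; field_simp; ring
      have : 0 ≤ t⁻¹ * (t * |p| - |q|) ^ 2 := by positivity
      linarith
    calc _ ≤ |p * q * ((d 1 (x * b) : ℝ) - d 1 x)| := le_abs_self _
      _ = |p * q| * |(d 1 (x * b) : ℝ) - d 1 x| := abs_mul _ _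
      _ ≤ (t * p ^ 2 + t⁻¹ * q ^ 2) / 2 * d 1 b := by
        exact mul_le_mul h9 (hb x b) (abs_nonneg _) (by positivity)
      _ = _ := by ring

theorem HypMetric.gap_aux {d : Γ → Γ → ℕ} {δ : ℕ} (H : HypMetric d δ) (f : L2 Γ) (M : ℝ)
    (hM : ∀ s, d 1 s ≤ 1 → ‖f - RT s f‖ ≤ M) :
    ∀ n : ℕ, ∀ b, d 1 b = n → ‖f - RT b f‖ ≤ n * M := by
  intro n
  induction n with
  | zero =>
    intro b hb
    have : 1 = b := H.eq _ _ hb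
    subst this
    simp [RT_one]
  | succ n ih =>
    intro b hb
    obtain ⟨z, h1, h2⟩ := H.pt 1 b n (by omega)
    have h3 := ih z h1
    have h4 := hM (z⁻¹ * b) (by rw [← H.dist_eq]; omega)
    have e : f - RT b f = (f - RT z f) + RT z (f - RT (z⁻¹ * b) f) := by
      have : RT b f = RT z (RT (z⁻¹ * b) f) := by
        rw [← mul_apply_eq_comp, ← RT_mul]; simp
      rw [this, map_sub]; abel
    rw [e]
    refine (norm_add_le _ _).trans ?_
    rw [RT_norm]
    push_cast
    linarith

theorem HypMetric.gap {d : Γ → Γ → ℕ} {δ : ℕ} (H : HypMetric d δ) (hne : Nonelementary Γ) :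
    ∃ c : ℝ, 0 < c ∧ ∀ f : L2 Γ, ∃ s, d 1 s ≤ 1 ∧ c * ‖f‖ ≤ ‖f - RT s f‖ := by
  obtain ⟨v, t, hvt⟩ := H.exists_pair hne
  obtain ⟨L, hL⟩ : ∃ L : ℝ, L = d 1 v + d 1 t + 1 := ⟨_, rfl⟩
  have hv0 : (0 : ℝ) ≤ d 1 v := by positivity
  have ht0 : (0 : ℝ) ≤ d 1 t := by positivity
  have hL1 : 1 ≤ L := by linarith
  refine ⟨1 / (8 * L ^ 2), by positivity, fun f => ?_⟩
  by_contra hcon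
  push Not at hcon
  have hM := H.gap_aux f (1 / (8 * L ^ 2) * ‖f‖) (fun s hs => (hcon s hs).le)
  have hf : 0 < ‖f‖ := by
    rcases (norm_nonneg f).eq_or_lt with h | h
    · have := hcon 1 (by rw [H.self]; omega)
      rw [← h, mul_zero] at this
      exact absurd this (not_lt.2 (norm_nonneg _))
    · exact h
  have hD : ∀ b, (d 1 b : ℝ) ≤ L → ‖f - RT b f‖ ≤ 1 / (8 * L) * ‖f‖ := by
    intro b hb
    refine (hM _ b rfl).trans ?_
    calc (d 1 b : ℝ) * (1 / (8 * L ^ 2) * ‖f‖) ≤ L * (1 / (8 * L ^ 2) * ‖f‖) := by gcongr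
      _ = _ := by field_simp
  have hDs : ∀ b, (d 1 b : ℝ) ≤ L → ‖f - RT b f‖ ^ 2 ≤ ‖f‖ ^ 2 / (64 * L ^ 2) := by
    intro b hb
    calc ‖f - RT b f‖ ^ 2 ≤ (1 / (8 * L) * ‖f‖) ^ 2 :=
          pow_le_pow_left₀ (norm_nonneg _) (hD b hb) 2
      _ = _ := by field_simp; ring
  obtain ⟨A, A', h1, h2, h3⟩ := H.pair_est f v (8 * L) (by positivity)
  obtain ⟨C, C', h4, h5, h6⟩ := H.pair_est f t (8 * L) (by positivity)
  have h7 := hasSum_le (fun x => ?_) (l2_hasSum f) ((h1.add h2).add (h4.add h5))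
  · have hb : ∀ b : Γ, (d 1 b : ℝ) ≤ L →
      (8 * L) * ‖f - RT b f‖ ^ 2 + 4 * ‖f‖ ^ 2 / (8 * L) ≤ (5 / 8) * ‖f‖ ^ 2 / L := by
      intro b hb
      have := hDs b hb
      calc _ ≤ (8 * L) * (‖f‖ ^ 2 / (64 * L ^ 2)) + 4 * ‖f‖ ^ 2 / (8 * L) := by gcongr
        _ = _ := by field_simp; ring
    have hv1 : (d 1 v : ℝ) ≤ L := by linarith
    have ht1 : (d 1 t : ℝ) ≤ L := by linarith
    have e1 : A + A' ≤ d 1 v * ((5 / 8) * ‖f‖ ^ 2 / L) / 2 := h3.trans (by gcongr; exact hb v hv1)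
    have e2 : C + C' ≤ d 1 t * ((5 / 8) * ‖f‖ ^ 2 / L) / 2 := h6.trans (by gcongr; exact hb t ht1)
    have e3 : (d 1 v + d 1 t : ℝ) * ((5 / 8) * ‖f‖ ^ 2 / L) / 2 ≤
        L * ((5 / 8) * ‖f‖ ^ 2 / L) / 2 := by gcongr; linarith
    have e4 : L * ((5 / 8) * ‖f‖ ^ 2 / L) / 2 = (5 / 16) * ‖f‖ ^ 2 := by field_simp; norm_num
    nlinarith [sq_nonneg ‖f‖, pow_pos hf 2]
  · have := hvt x
    have h8 : (4 * d 1 x + 1 : ℝ) ≤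
      d 1 (x * v) + d 1 (x * v⁻¹) + d 1 (x * t) + d 1 (x * t⁻¹) := by exact_mod_cast this
    nlinarith [sq_nonneg (f x)]

/-- Positive operators. -/
def Pos (T : L2 Γ →L[ℝ] L2 Γ) : Prop := ∀ f : L2 Γ, (∀ x, 0 ≤ f x) → ∀ x, 0 ≤ T f x

theorem Pos.one : Pos (1 : L2 Γ →L[ℝ] L2 Γ) := fun _ h => h
theorem Pos.zero : Pos (0 : L2 Γ →L[ℝ] L2 Γ) := fun _ _ _ => le_rfl
theorem Pos.add {T U : L2 Γ →L[ℝ] L2 Γ} (hT : Pos T) (hU : Pos U) : Pos (T + U) :=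
  fun f h x => add_nonneg (hT f h x) (hU f h x)
theorem Pos.smul {T : L2 Γ →L[ℝ] L2 Γ} {c : ℝ} (hc : 0 ≤ c) (hT : Pos T) : Pos (c • T) :=
  fun f h x => mul_nonneg hc (hT f h x)
theorem Pos.mul {T U : L2 Γ →L[ℝ] L2 Γ} (hT : Pos T) (hU : Pos U) : Pos (T * U) :=
  fun f h x => hT _ (hU f h) x
theorem Pos.pow {T : L2 Γ →L[ℝ] L2 Γ} (hT : Pos T) : ∀ n : ℕ, Pos (T ^ n)
  | 0 => by rw [pow_zero]; exact Pos.one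
  | n + 1 => by rw [pow_succ]; exact (hT.pow n).mul hT
theorem Pos.sum {ι : Type*} (s : Finset ι) (T : ι → L2 Γ →L[ℝ] L2 Γ)
    (h : ∀ i ∈ s, Pos (T i)) : Pos (∑ i ∈ s, T i) := by
  classical
  induction s using Finset.induction_on with
  | empty => simpa using Pos.zero
  | insert a s ha ih =>
    rw [Finset.sum_insert ha]
    exact (h a (by simp)).add (ih fun i hi => h i (by simp [hi]))
theorem Pos.RT (s : Γ) : Pos (RT s) := fun _ h x => h (x * s)
theorem Pos.mono {T : L2 Γ →L[ℝ] L2 Γ} (hT : Pos T) {f g : L2 Γ} (h : ∀ x, f x ≤ g x) (x : Γ) :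
    T f x ≤ T g x := by
  have := hT (g - f) (fun x => sub_nonneg.2 (h x)) x
  rw [map_sub] at this
  exact sub_nonneg.1 this

theorem RT_opNorm (s : Γ) : ‖RT s‖ ≤ 1 :=
  ContinuousLinearMap.opNorm_le_bound _ zero_le_one fun f => by rw [RT_norm, one_mul]

theorem opNorm_one_le : ‖(1 : L2 Γ →L[ℝ] L2 Γ)‖ ≤ 1 :=
  ContinuousLinearMap.opNorm_le_bound _ zero_le_one fun f => by simp

/-- Point mass. -/
noncomputable def dl (y : Γ) : L2 Γ := by classical exact lp.single 2 y 1

open Classical in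
theorem dl_apply (y x : Γ) : dl y x = if x = y then 1 else 0 := by
  unfold dl
  by_cases h : x = y
  · subst h; simp
  · simp [h]

theorem dl_self (y : Γ) : dl y y = 1 := by rw [dl_apply]; simp
theorem dl_ne {y x : Γ} (h : x ≠ y) : dl y x = 0 := by rw [dl_apply]; simp [h]
theorem dl_nonneg (y x : Γ) : 0 ≤ dl y x := by rw [dl_apply]; split_ifs <;> norm_num
theorem dl_norm (y : Γ) : ‖dl y‖ = 1 := by
  classical
  have := lp.norm_single (E := fun _ : Γ => ℝ) (p := 2) (by norm_num) y (1 : ℝ)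
  rw [norm_one] at this
  unfold dl
  convert this

theorem RT_dl (s y : Γ) : RT s (dl y) = dl (y * s⁻¹) := by
  apply l2_ext; intro x
  rw [RT_apply, dl_apply, dl_apply]
  by_cases h : x * s = y
  · rw [if_pos h, if_pos (eq_mul_inv_iff_mul_eq.2 h)]
  · rw [if_neg h, if_neg fun h2 => h (eq_mul_inv_iff_mul_eq.1 h2)]

theorem l2_hasSum_dl (f : L2 Γ) : HasSum (fun z => f z • dl z) f := by
  classical
  have := lp.hasSum_single (E := fun _ : Γ => ℝ) (p := 2) (by norm_num) f
  convert this using 2 with z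
  apply l2_ext; intro x
  rw [l2_smul, dl_apply]
  by_cases h : x = z
  · subst h; simp
  · simp [h]

theorem op_hasSum (T : L2 Γ →L[ℝ] L2 Γ) (f : L2 Γ) (x : Γ) :
    HasSum (fun z => f z * T (dl z) x) (T f x) := by
  have h := (l2_hasSum_dl f).mapL ((lp.evalCLM (𝕜 := ℝ) (fun _ : Γ => ℝ) 2 x).comp T)
  simp only [map_smul] at h
  exact h

/-- The properties of the averaged walk that are used. -/
structure Walk (d : Γ → Γ → ℕ) (M : ℕ) (κ ρ : ℝ) (T : L2 Γ →L[ℝ] L2 Γ) : Prop where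
  pos : Pos T
  norm : ‖T‖ ≤ ρ
  rho : ρ < 1
  kap0 : 0 < κ
  kap1 : κ ≤ 1
  supp : ∀ x z, T (dl z) x ≠ 0 → d x z ≤ M
  low : ∀ f : L2 Γ, (∀ x, 0 ≤ f x) → ∀ x s, d 1 s ≤ 1 → κ * f (x * s) ≤ T f x

/-- One-step operator. -/
noncomputable def stepOp (μ : Γ → ℝ) (F : Finset Γ) : L2 Γ →L[ℝ] L2 Γ := ∑ s ∈ F, μ s • RT s

theorem stepOp_apply (μ : Γ → ℝ) (F : Finset Γ) (f : L2 Γ) (x : Γ) :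
    stepOp μ F f x = ∑ s ∈ F, μ s * f (x * s) := by
  unfold stepOp
  rw [sum_apply, l2_sum]
  rfl

section
variable {S : Set Γ} {μ : Γ → ℝ} {F : Finset Γ}

theorem ptrans_eq (hF : ∀ s, μ s ≠ 0 → s ∈ F) (n : ℕ) (x y : Γ) :
    ptrans μ n x y = ((stepOp μ F) ^ n) (dl y) x := by
  induction n generalizing x y with
  | zero => rw [ptrans, pow_zero, one_apply_eq_self, dl_apply]
  | succ n ih =>
    rw [ptrans, pow_succ, mul_apply_eq_comp]
    have e : stepOp μ F (dl y) = ∑ s ∈ F, μ s • dl (y * s⁻¹) := by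
      unfold stepOp
      rw [sum_apply]
      refine Finset.sum_congr rfl fun s _ => ?_
      rw [smul_apply, RT_dl]
    rw [e, map_sum, l2_sum]
    have e2 : ∑' z, ptrans μ n x z * μ (z⁻¹ * y) =
        ∑' s, ptrans μ n x (y * s⁻¹) * μ ((y * s⁻¹)⁻¹ * y) :=
      (((Equiv.inv Γ).trans (Equiv.mulLeft y)).tsum_eq
        (fun z => ptrans μ n x z * μ (z⁻¹ * y))).symm
    refine e2.trans ?_
    rw [tsum_eq_sum (s := F)]
    · refine Finset.sum_congr rfl fun s _ => ?_
      rw [map_smul, l2_smul, ih]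
      simp [mul_comm]
    · intro s hs
      have : μ s = 0 := by_contra fun h => hs (hF s h)
      simp [this]

theorem stepOp_split (hμ0 : ∀ s, 0 ≤ μ s) (hF1 : ∑ s ∈ F, μ s = 1) {s : Γ} (hs : s ∈ F) :
    ∃ Q, Pos Q ∧ ‖Q‖ ≤ 1 - μ s ∧ stepOp μ F = μ s • RT s + Q := by
  classical
  refine ⟨∑ t ∈ F.erase s, μ t • RT t, Pos.sum _ _ fun t _ => (Pos.RT t).smul (hμ0 t), ?_, ?_⟩
  · refine (norm_sum_le _ _).trans ?_
    have : ∑ t ∈ F.erase s, μ t = 1 - μ s := by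
      rw [← hF1, ← Finset.add_sum_erase _ _ hs]; ring
    rw [← this]
    refine Finset.sum_le_sum fun t _ => ?_
    rw [norm_smul, Real.norm_of_nonneg (hμ0 t)]
    nlinarith [RT_opNorm t, hμ0 t]
  · unfold stepOp
    exact (Finset.add_sum_erase F (fun t => μ t • RT t) hs).symm

theorem stepOp_pos (hμ0 : ∀ s, 0 ≤ μ s) : Pos (stepOp μ F) :=
  Pos.sum _ _ fun t _ => (Pos.RT t).smul (hμ0 t)

theorem stepOp_norm (hμ0 : ∀ s, 0 ≤ μ s) (hF1 : ∑ s ∈ F, μ s = 1) : ‖stepOp μ F‖ ≤ 1 := by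
  unfold stepOp
  refine (norm_sum_le _ _).trans ?_
  rw [← hF1]
  refine Finset.sum_le_sum fun t _ => ?_
  rw [norm_smul, Real.norm_of_nonneg (hμ0 t)]
  nlinarith [RT_opNorm t, hμ0 t]

theorem pow_norm_le_one {P : L2 Γ →L[ℝ] L2 Γ} (hP : ‖P‖ ≤ 1) : ∀ n : ℕ, ‖P ^ n‖ ≤ 1
  | 0 => by rw [pow_zero]; exact opNorm_one_le
  | n + 1 => by
    rw [pow_succ]
    refine (norm_mul_le _ _).trans ?_
    exact mul_le_one₀ (pow_norm_le_one hP n) (norm_nonneg _) hP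

theorem stepOp_list (hμ0 : ∀ s, 0 ≤ μ s) (hF : ∀ s, μ s ≠ 0 → s ∈ F) (hF1 : ∑ s ∈ F, μ s = 1)
    (l : List Γ) (hl : ∀ x ∈ l, 0 < μ x) :
    ∃ κ : ℝ, 0 < κ ∧ ∃ Q, Pos Q ∧ ‖Q‖ ≤ 1 - κ ∧
      (stepOp μ F) ^ l.length = κ • RT l.prod + Q := by
  induction l with
  | nil => exact ⟨1, one_pos, 0, Pos.zero, by simp, by simp [RT_one]⟩
  | cons s l ih =>
    obtain ⟨κ, hκ, Q, hQ, hQn, e⟩ := ih fun x hx => hl x (by simp [hx])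
    have hs : 0 < μ s := hl s (by simp)
    obtain ⟨Q', hQ', hQn', e'⟩ := stepOp_split hμ0 hF1 (hF s hs.ne')
    refine ⟨μ s * κ, mul_pos hs hκ, (μ s • RT s) * Q + Q' * (stepOp μ F) ^ l.length,
      (((Pos.RT s).smul hs.le).mul hQ).add (hQ'.mul ((stepOp_pos hμ0).pow _)), ?_, ?_⟩
    · refine (norm_add_le _ _).trans ?_
      have h1 : ‖(μ s • RT s) * Q‖ ≤ μ s * (1 - κ) := by
        refine (norm_mul_le _ _).trans ?_
        refine mul_le_mul ?_ hQn (norm_nonneg _) hs.le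
        rw [norm_smul, Real.norm_of_nonneg hs.le]
        nlinarith [RT_opNorm s]
      have h2 : ‖Q' * (stepOp μ F) ^ l.length‖ ≤ (1 - μ s) * 1 := by
        refine (norm_mul_le _ _).trans ?_
        exact mul_le_mul hQn' (pow_norm_le_one (stepOp_norm hμ0 hF1) _) (norm_nonneg _)
          ((norm_nonneg _).trans hQn')
      linarith
    · rw [List.length_cons, pow_succ', List.prod_cons, RT_mul]
      nth_rewrite 1 [e']
      rw [add_mul]
      nth_rewrite 1 [e]
      rw [mul_add, smul_mul_smul_comm, add_assoc]

end

/-- averaged operator -/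
noncomputable def avgOp (P : L2 Γ →L[ℝ] L2 Γ) (M : ℕ) : L2 Γ →L[ℝ] L2 Γ :=
  (M : ℝ)⁻¹ • ∑ n ∈ Finset.range M, P ^ n

theorem avg_split {P : L2 Γ →L[ℝ] L2 Γ} (hP : Pos P) (hP1 : ‖P‖ ≤ 1) {M n : ℕ} (hn : 1 ≤ n)
    (hM : n < M) {κ : ℝ} (hκ : 0 < κ) {Q R : L2 Γ →L[ℝ] L2 Γ} (hR : Pos R) (hR1 : ‖R‖ ≤ 1)
    (hQ : Pos Q) (hQ1 : ‖Q‖ ≤ 1 - κ)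
    (e : P ^ n = κ • R + Q) {κ' : ℝ} (hκ' : 0 < κ') (hle : κ' ≤ κ / M) :
    ∃ Q', Pos Q' ∧ ‖Q'‖ ≤ 1 - 2 * κ' ∧ avgOp P M = κ' • (1 + R) + Q' := by
  have hM0 : (0 : ℝ) < M := by exact_mod_cast (by omega : 0 < M)
  have hκ1 : κ ≤ 1 := by linarith [norm_nonneg Q]
  have hle1 : κ' ≤ (M : ℝ)⁻¹ := by
    refine hle.trans ?_
    rw [div_eq_mul_inv]
    nlinarith [inv_pos.2 hM0]
  have hle2 : κ' ≤ (M : ℝ)⁻¹ * κ := by rw [div_eq_inv_mul] at hle; exact hle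
  set E := ((Finset.range M).erase 0).erase n with hE
  have hs : ∑ k ∈ Finset.range M, P ^ k = 1 + (P ^ n + ∑ k ∈ E, P ^ k) := by
    rw [hE, Finset.add_sum_erase _ (fun k => P ^ k) (by simp; omega)]
    rw [← Finset.add_sum_erase (Finset.range M) (fun k => P ^ k) (a := 0) (by simp; omega)]
    simp
  have hc : E.card = M - 2 := by
    rw [hE, Finset.card_erase_of_mem (by simp; omega), Finset.card_erase_of_mem (by simp; omega)]
    simp; omega
  have hc' : (E.card : ℝ) = M - 2 := by
    rw [hc, Nat.cast_sub (by omega)]; norm_num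
  refine ⟨((M : ℝ)⁻¹ - κ') • 1 + ((M : ℝ)⁻¹ * κ - κ') • R + (M : ℝ)⁻¹ • Q +
    (M : ℝ)⁻¹ • ∑ k ∈ E, P ^ k, ?_, ?_, ?_⟩
  · refine (((Pos.one.smul (by linarith)).add (hR.smul (by linarith))).add
      (hQ.smul (by positivity))).add ((Pos.sum _ _ fun k _ => hP.pow k).smul (by positivity))
  · have n1 : ‖((M : ℝ)⁻¹ - κ') • (1 : L2 Γ →L[ℝ] L2 Γ)‖ ≤ (M : ℝ)⁻¹ - κ' := by
      rw [norm_smul, Real.norm_of_nonneg (by linarith)]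
      exact mul_le_of_le_one_right (by linarith) opNorm_one_le
    have n2 : ‖((M : ℝ)⁻¹ * κ - κ') • R‖ ≤ (M : ℝ)⁻¹ * κ - κ' := by
      rw [norm_smul, Real.norm_of_nonneg (by linarith)]
      exact mul_le_of_le_one_right (by linarith) hR1
    have n3 : ‖(M : ℝ)⁻¹ • Q‖ ≤ (M : ℝ)⁻¹ * (1 - κ) := by
      rw [norm_smul, Real.norm_of_nonneg (by positivity)]
      gcongr
    have n4 : ‖(M : ℝ)⁻¹ • ∑ k ∈ E, P ^ k‖ ≤ (M : ℝ)⁻¹ * (M - 2) := by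
      rw [norm_smul, Real.norm_of_nonneg (by positivity)]
      gcongr
      refine (norm_sum_le_of_le _ (fun k _ => pow_norm_le_one hP1 k)).trans ?_
      rw [Finset.sum_const, nsmul_eq_mul, mul_one, hc']
    have e2 : (M : ℝ)⁻¹ * (M - 2) = 1 - 2 * (M : ℝ)⁻¹ := by field_simp
    refine (norm_add_le _ _).trans ?_
    refine (add_le_add ((norm_add_le _ _).trans (add_le_add (norm_add_le _ _) le_rfl)) le_rfl).trans
      ?_
    linarith
  · rw [avgOp, hs, e]
    module

theorem norm_combo {f : L2 Γ} {s : Γ} {c : ℝ} (hc : 0 ≤ c) (h : c * ‖f‖ ≤ ‖f - RT s f‖) :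
    ‖f + RT s f‖ ≤ Real.sqrt (4 - c ^ 2) * ‖f‖ := by
  have h1 := parallelogram_law_with_norm ℝ f (RT s f)
  rw [RT_norm] at h1
  have h2 : (c * ‖f‖) ^ 2 ≤ ‖f - RT s f‖ ^ 2 := pow_le_pow_left₀ (by positivity) h 2
  have h3 : ‖f + RT s f‖ ^ 2 ≤ (4 - c ^ 2) * ‖f‖ ^ 2 := by nlinarith
  have h4 := Real.sqrt_le_sqrt h3
  rw [Real.sqrt_sq (norm_nonneg _), Real.sqrt_mul' _ (sq_nonneg _), Real.sqrt_sq (norm_nonneg _)]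
    at h4
  exact h4

theorem pow_supp {d : Γ → Γ → ℕ} {δ : ℕ} (H : HypMetric d δ) {P : L2 Γ →L[ℝ] L2 Γ} {m : ℕ}
    (hP : ∀ x z, P (dl z) x ≠ 0 → d x z ≤ m) (n : ℕ) (x z : Γ)
    (h : (P ^ n) (dl z) x ≠ 0) : d x z ≤ n * m := by
  induction n generalizing x with
  | zero =>
    rw [pow_zero, one_apply_eq_self] at h
    have : x = z := by_contra fun h2 => h (dl_ne h2)
    rw [this, H.self]; omega
  | succ n ih =>
    rw [pow_succ', mul_apply_eq_comp] at h
    have h1 := op_hasSum P ((P ^ n) (dl z)) x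
    by_contra hcon
    refine h (h1.unique ?_)
    have : (fun w => (P ^ n) (dl z) w * P (dl w) x) = fun _ => 0 := by
      funext w
      by_contra h2
      obtain ⟨h3, h4⟩ := mul_ne_zero_iff.1 h2
      have h5 := ih w h3
      have h6 := hP x w h4
      have h7 := H.tri x w z
      rw [add_mul] at hcon
      omega
    rw [this]; exact hasSum_zero

/-- auxiliary potential operator -/
noncomputable def qOp (P : L2 Γ →L[ℝ] L2 Γ) (M : ℕ) : L2 Γ →L[ℝ] L2 Γ :=
  (M : ℝ)⁻¹ • ∑ n ∈ Finset.range M, ∑ j ∈ Finset.range n, P ^ j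

theorem qOp_mul (P : L2 Γ →L[ℝ] L2 Γ) {M : ℕ} (hM : 0 < M) :
    qOp P M * (1 - P) = 1 - avgOp P M := by
  have hM0 : (M : ℝ) ≠ 0 := by exact_mod_cast hM.ne'
  have : ∀ n, (∑ j ∈ Finset.range n, P ^ j) * (1 - P) = 1 - P ^ n := fun n => geom_sum_mul_neg P n
  rw [qOp, avgOp, smul_mul_assoc, Finset.sum_mul]
  simp only [this]
  rw [Finset.sum_sub_distrib, smul_sub, Finset.sum_const, Finset.card_range,
    ← Nat.cast_smul_eq_nsmul ℝ, smul_smul, inv_mul_cancel₀ hM0, one_smul]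

theorem qOp_comm (P : L2 Γ →L[ℝ] L2 Γ) (M : ℕ) : Commute P (qOp P M) := by
  unfold qOp
  refine Commute.smul_right (Commute.sum_right _ _ _ fun n _ => Commute.sum_right _ _ _ fun j _ =>
    (Commute.refl P).pow_right j) _

theorem qOp_pos {P : L2 Γ →L[ℝ] L2 Γ} (hP : Pos P) (M : ℕ) : Pos (qOp P M) :=
  (Pos.sum _ _ fun n _ => Pos.sum _ _ fun j _ => hP.pow j).smul (by positivity)

/-- Neumann series -/
noncomputable def neu (T : L2 Γ →L[ℝ] L2 Γ) : L2 Γ →L[ℝ] L2 Γ := ∑' n, T ^ n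

theorem neu_summable {T : L2 Γ →L[ℝ] L2 Γ} (h : ‖T‖ < 1) : Summable fun n => T ^ n :=
  summable_geometric_of_norm_lt_one h

theorem neu_left {T : L2 Γ →L[ℝ] L2 Γ} (h : ‖T‖ < 1) : (1 - T) * neu T = 1 :=
  mul_neg_geom_series T h

theorem neu_right {T : L2 Γ →L[ℝ] L2 Γ} (h : ‖T‖ < 1) : neu T * (1 - T) = 1 :=
  geom_series_mul_neg T h

theorem neu_hasSum {T : L2 Γ →L[ℝ] L2 Γ} (h : ‖T‖ < 1) (f : L2 Γ) (x : Γ) :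
    HasSum (fun n => (T ^ n) f x) (neu T f x) := by
  have h1 := (neu_summable h).hasSum
  have h2 := h1.mapL ((lp.evalCLM (𝕜 := ℝ) (fun _ : Γ => ℝ) 2 x).comp
    (ContinuousLinearMap.apply ℝ (L2 Γ) f))
  exact h2

theorem neu_pos {T : L2 Γ →L[ℝ] L2 Γ} (h : ‖T‖ < 1) (hT : Pos T) : Pos (neu T) :=
  fun f hf x => (neu_hasSum h f x).nonneg fun n => hT.pow n f hf x

theorem exists_walk {S : Set Γ} {μ : Γ → ℝ} {δ : ℕ} (H : HypMetric (wdist S) δ)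
    (hne : Nonelementary Γ) (hS : IsGenSet S) (hμ : IsRWMeasure S μ) :
    ∃ (M : ℕ) (κ ρ : ℝ) (T : L2 Γ →L[ℝ] L2 Γ), Walk (wdist S) M κ ρ T ∧
      ∀ y, ∃ G : L2 Γ, (∀ x, G x = green μ x y) ∧ (∀ x, 0 ≤ G x) ∧ 1 ≤ G y ∧
        (∀ x, M < wdist S x y → T G x = G x) ∧ ∀ x, T G x ≤ G x := by
  classical
  obtain ⟨F, hF⟩ : ∃ F : Finset Γ, ∀ s, s ∈ F ↔ μ s ≠ 0 :=
    ⟨(hS.1.subset fun g hg => hμ.support_subset g hg : {g | μ g ≠ 0}.Finite).toFinset, by simp⟩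
  have hF' : ∀ s, μ s ≠ 0 → s ∈ F := fun s => (hF s).2
  have hF1 : ∑ s ∈ F, μ s = 1 := by
    rw [← hμ.total, tsum_eq_sum (s := F)]
    intro b hb
    exact by_contra fun h => hb (hF' b h)
  have hμ0 := hμ.nonneg
  set P := stepOp μ F with hPdef
  have hP : Pos P := stepOp_pos hμ0
  have hP1 : ‖P‖ ≤ 1 := stepOp_norm hμ0 hF1
  -- ball
  obtain ⟨b1, hb1⟩ : ∃ b1 : Finset Γ, ∀ s, s ∈ b1 ↔ wdist S 1 s ≤ 1 :=
    ⟨(H.fin 1).toFinset, by simp⟩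
  have hdec : ∀ b : Γ, ∃ n : ℕ, 1 ≤ n ∧ ∃ κ : ℝ, 0 < κ ∧ ∃ Q, Pos Q ∧ ‖Q‖ ≤ 1 - κ ∧
      P ^ n = κ • RT b + Q := by
    intro b
    obtain ⟨l, hl0, hl, hlb⟩ := hμ.nondeg b
    obtain ⟨κ, hκ, Q, hQ, hQ1, e⟩ := stepOp_list hμ0 hF' hF1 l hl
    exact ⟨l.length, List.length_pos_iff.2 hl0, κ, hκ, Q, hQ, hQ1, by rw [e, hlb]⟩
  choose nn hnn kk hkk QQ hQQ hQQ1 hdec using hdec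
  obtain ⟨M, hM⟩ : ∃ M : ℕ, M = b1.sup nn + 1 := ⟨_, rfl⟩
  have hMn : ∀ b ∈ b1, nn b < M := fun b hb => by
    have := Finset.le_sup (f := nn) hb; omega
  have h1b : (1 : Γ) ∈ b1 := by rw [hb1, H.self]; omega
  obtain ⟨b0, hb0, hmin⟩ := Finset.exists_min_image b1 kk ⟨1, h1b⟩
  obtain ⟨κ, hκ⟩ : ∃ κ : ℝ, κ = kk b0 / M := ⟨_, rfl⟩
  have hM0 : (0 : ℝ) < M := by exact_mod_cast (by omega : 0 < M)
  have hκ0 : 0 < κ := hκ ▸ div_pos (hkk b0) hM0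
  obtain ⟨T, hT⟩ : ∃ T, T = avgOp P M := ⟨_, rfl⟩
  have hsplit : ∀ b ∈ b1, ∃ Q', Pos Q' ∧ ‖Q'‖ ≤ 1 - 2 * κ ∧ T = κ • (1 + RT b) + Q' := by
    intro b hb
    rw [hT]
    refine avg_split hP hP1 (hnn b) (hMn b hb) (hkk b) (Pos.RT b) (RT_opNorm b) (hQQ b) (hQQ1 b)
      (hdec b) hκ0 ?_
    rw [hκ]
    have := hmin b hb
    gcongr
  have hTpos : Pos T := by
    rw [hT]; exact (Pos.sum _ _ fun n _ => hP.pow n).smul (by positivity)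
  obtain ⟨c, hc, hgap⟩ := H.gap hne
  obtain ⟨Q1, _, hQ1n, _⟩ := hsplit 1 h1b
  have hκ2 : 2 * κ ≤ 1 := by linarith [norm_nonneg Q1]
  obtain ⟨ρ, hρ⟩ : ∃ ρ : ℝ, ρ = κ * Real.sqrt (4 - c ^ 2) + (1 - 2 * κ) := ⟨_, rfl⟩
  have hρ0 : 0 ≤ ρ := by
    rw [hρ]; have := Real.sqrt_nonneg (4 - c ^ 2); nlinarith [mul_nonneg hκ0.le this]
  have hρ1 : ρ < 1 := by
    have : Real.sqrt (4 - c ^ 2) < 2 := by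
      rw [Real.sqrt_lt' (by norm_num)]; nlinarith
    rw [hρ]; nlinarith
  have hTn : ‖T‖ ≤ ρ := by
    refine ContinuousLinearMap.opNorm_le_bound _ hρ0 fun f => ?_
    obtain ⟨s, hs, hsf⟩ := hgap f
    obtain ⟨Q, hQ, hQn, e⟩ := hsplit s ((hb1 s).2 hs)
    have e2 : T f = κ • (f + RT s f) + Q f := by rw [e]; rfl
    rw [e2, hρ]
    refine (norm_add_le _ _).trans ?_
    rw [norm_smul, Real.norm_of_nonneg hκ0.le, add_mul, mul_assoc]
    refine add_le_add (mul_le_mul_of_nonneg_left (norm_combo hc.le hsf) hκ0.le) ?_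
    exact (Q.le_opNorm f).trans (by gcongr)
  have hPsupp : ∀ x z, P (dl z) x ≠ 0 → wdist S x z ≤ 1 := by
    intro x z h
    rw [hPdef, stepOp_apply] at h
    obtain ⟨s, hs, hs2⟩ := Finset.exists_ne_zero_of_sum_ne_zero h
    obtain ⟨h1, h2⟩ := mul_ne_zero_iff.1 hs2
    have h3 : x * s = z := by_contra fun h => h2 (dl_ne h)
    rw [← h3, H.dist_mul]
    rw [wdist, inv_one, one_mul]
    have h4 := hμ.support_subset s h1
    have h5 := wl_le (S := S) [s] (by simpa using h4)
    simpa using h5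
  have hPnsupp : ∀ n x z, (P ^ n) (dl z) x ≠ 0 → wdist S x z ≤ n := by
    intro n x z h
    simpa using pow_supp H hPsupp n x z h
  have hTsupp : ∀ x z, T (dl z) x ≠ 0 → wdist S x z ≤ M := by
    intro x z h
    by_contra hcon
    apply h
    rw [hT, avgOp, smul_apply, l2_smul, sum_apply, l2_sum, Finset.sum_eq_zero, mul_zero]
    intro n hn
    by_contra h2
    have := hPnsupp n x z h2
    have := Finset.mem_range.1 hn
    omega
  refine ⟨M, κ, ρ, T, ⟨hTpos, hTn, hρ1, hκ0, by linarith, hTsupp, ?_⟩, ?_⟩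
  · intro f hf x s hs
    obtain ⟨Q, hQ, hQn, e⟩ := hsplit s ((hb1 s).2 hs)
    have e2 : T f x = κ * (f x + f (x * s)) + Q f x := by rw [e]; rfl
    rw [e2]
    nlinarith [hQ f hf x, mul_nonneg hκ0.le (hf x)]
  · intro y
    have hT1 : ‖T‖ < 1 := hTn.trans_lt hρ1
    set q := qOp P M with hq
    have hqm : q * (1 - P) = 1 - T := by rw [hT]; exact qOp_mul P (by omega)
    have hqc : Commute P q := qOp_comm P M
    have hPT : Commute P T := by
      rw [hT, avgOp]
      exact Commute.smul_right (Commute.sum_right _ _ _ fun n _ => (Commute.refl P).pow_right n) _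
    have hNP : neu T * P = P * neu T := by
      calc neu T * P = neu T * P * ((1 - T) * neu T) := by rw [neu_left hT1, mul_one]
        _ = neu T * (P * (1 - T)) * neu T := by noncomm_ring
        _ = neu T * ((1 - T) * P) * neu T := by
          rw [((Commute.one_right P).sub_right hPT).eq]
        _ = (neu T * (1 - T)) * P * neu T := by noncomm_ring
        _ = _ := by rw [neu_right hT1, one_mul]
    set u := (neu T * q) (dl y) with hu
    have hupos : ∀ x, 0 ≤ u x :=
      ((neu_pos hT1 hTpos).mul (qOp_pos hP M)) (dl y) (dl_nonneg y)
    have hu1 : (1 - P) * (neu T * q) = 1 := by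
      calc (1 - P) * (neu T * q) = (neu T - P * neu T) * q := by noncomm_ring
        _ = neu T * (q - P * q) := by rw [← hNP]; noncomm_ring
        _ = neu T * (q * (1 - P)) := by rw [hqc.eq]; noncomm_ring
        _ = 1 := by rw [hqm, neu_right hT1]
    have hpart : ∀ k x, ∑ n ∈ Finset.range k, ptrans μ n x y ≤ u x := by
      intro k x
      have e1 : (∑ n ∈ Finset.range k, P ^ n) (dl y) = u - (P ^ k) u := by
        have : (∑ n ∈ Finset.range k, P ^ n) = (1 - P ^ k) * (neu T * q) := by
          rw [← geom_sum_mul_neg P k, mul_assoc, hu1, mul_one]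
        rw [this]; rfl
      have e2 : ∑ n ∈ Finset.range k, ptrans μ n x y = (∑ n ∈ Finset.range k, P ^ n) (dl y) x := by
        rw [sum_apply, l2_sum]
        exact Finset.sum_congr rfl fun n _ => ptrans_eq hF' n x y
      rw [e2, e1, l2_sub]
      linarith [hP.pow k u hupos x]
    have hpn : ∀ n x, 0 ≤ ptrans μ n x y := fun n x => by
      rw [ptrans_eq hF']; exact hP.pow n _ (dl_nonneg y) x
    have hsum : ∀ x, Summable fun n => ptrans μ n x y := fun x =>
      summable_of_sum_range_le (fun n => hpn n x) fun k => hpart k x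
    have hGu : ∀ x, green μ x y ≤ u x := fun x =>
      (hsum x).tsum_le_of_sum_range_le fun k => hpart k x
    have hG0 : ∀ x, 0 ≤ green μ x y := fun x => tsum_nonneg fun n => hpn n x
    set G : L2 Γ := l2mk (fun x => green μ x y) (Summable.of_nonneg_of_le (fun x => sq_nonneg _)
      (fun x => pow_le_pow_left₀ (hG0 x) (hGu x) 2) (l2_hasSum u).summable) with hGdef
    have hGx : ∀ x, G x = green μ x y := fun x => rfl
    have hGP : ∀ x, green μ x y = dl y x + P G x := by
      intro x
      rw [green, (hsum x).tsum_eq_zero_add]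
      congr 1
      · rw [ptrans_eq hF', pow_zero]; rfl
      · rw [hPdef, stepOp_apply]
        have : ∀ n, ptrans μ (n + 1) x y = ∑ s ∈ F, μ s * ptrans μ n (x * s) y := by
          intro n
          rw [ptrans_eq hF', pow_succ', mul_apply_eq_comp, stepOp_apply]
          exact Finset.sum_congr rfl fun s _ => by rw [ptrans_eq hF']
        simp only [this]
        rw [Summable.tsum_finsetSum fun s _ => (hsum (x * s)).mul_left _]
        exact Finset.sum_congr rfl fun s _ => tsum_mul_left
    have hGq : G - T G = q (dl y) := by
      have h1 : (1 - P) G = dl y := by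
        apply l2_ext; intro x
        show G x - P G x = dl y x
        rw [hGx, hGP]; ring
      have h2 : (q * (1 - P)) G = (1 - T) G := by rw [hqm]
      rw [mul_apply_eq_comp, h1] at h2
      rw [h2]; rfl
    have hGqx : ∀ x, G x - T G x = q (dl y) x := fun x => by rw [← hGq]; rfl
    refine ⟨G, hGx, hG0, ?_, ?_, ?_⟩
    · rw [hGx, hGP, dl_self]
      linarith [hP G hG0 y]
    · intro x hx
      have : q (dl y) x = 0 := by
        rw [hq, qOp, smul_apply, l2_smul, sum_apply, l2_sum, Finset.sum_eq_zero, mul_zero]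
        intro n hn
        rw [sum_apply, l2_sum, Finset.sum_eq_zero]
        intro j hj
        by_contra h2
        have := hPnsupp j x y h2
        have := Finset.mem_range.1 hn
        have := Finset.mem_range.1 hj
        omega
      linarith [hGqx x]
    · intro x
      linarith [hGqx x, qOp_pos hP M (dl y) (dl_nonneg y) x]

open Classical in
/-- restriction to a set -/
noncomputable def ind (Λ : Set Γ) : L2 Γ →L[ℝ] L2 Γ :=
  LinearMap.mkContinuous
    { toFun := fun f => l2mk (fun x => if x ∈ Λ then f x else 0)
        (Summable.of_nonneg_of_le (fun x => sq_nonneg _)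
          (fun x => by split_ifs <;> nlinarith [sq_nonneg (f x)]) (l2_hasSum f).summable)
      map_add' := fun f g => by
        apply l2_ext; intro x; simp only [l2mk_apply, l2_add]; split_ifs <;> simp
      map_smul' := fun c f => by
        apply l2_ext; intro x; simp only [l2mk_apply, l2_smul, RingHom.id_apply]
        split_ifs <;> simp } 1 (fun f => by
        rw [one_mul]
        apply l2_norm_mono
        intro x
        simp only [LinearMap.coe_mk, AddHom.coe_mk, l2mk_apply]
        split_ifs <;> simp)

open Classical in
theorem ind_apply (Λ : Set Γ) (f : L2 Γ) (x : Γ) : ind Λ f x = if x ∈ Λ then f x else 0 := rfl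

theorem ind_mem {Λ : Set Γ} {x : Γ} (h : x ∈ Λ) (f : L2 Γ) : ind Λ f x = f x := by
  rw [ind_apply, if_pos h]
theorem ind_not_mem {Λ : Set Γ} {x : Γ} (h : x ∉ Λ) (f : L2 Γ) : ind Λ f x = 0 := by
  rw [ind_apply, if_neg h]

theorem ind_pos (Λ : Set Γ) : Pos (ind Λ) := fun f hf x => by
  rw [ind_apply]; split_ifs
  · exact hf x
  · exact le_rfl

theorem ind_norm (Λ : Set Γ) : ‖ind Λ‖ ≤ 1 :=
  LinearMap.mkContinuous_norm_le _ zero_le_one _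

theorem ind_idem (Λ : Set Γ) : ind Λ * ind Λ = ind Λ := by
  ext1 f; apply l2_ext; intro x
  rw [mul_apply_eq_comp]
  by_cases h : x ∈ Λ
  · rw [ind_mem h]
  · rw [ind_not_mem h, ind_not_mem h]

theorem ind_dl {Λ : Set Γ} {z : Γ} (h : z ∈ Λ) : ind Λ (dl z) = dl z := by
  apply l2_ext; intro x
  by_cases hx : x ∈ Λ
  · rw [ind_mem hx]
  · rw [ind_not_mem hx, dl_ne]; rintro rfl; exact hx h

theorem ind_dl_not {Λ : Set Γ} {z : Γ} (h : z ∉ Λ) : ind Λ (dl z) = 0 := by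
  apply l2_ext; intro x
  by_cases hx : x ∈ Λ
  · rw [ind_mem hx, dl_ne, l2_zero]; rintro rfl; exact h hx
  · rw [ind_not_mem hx, l2_zero]

/-- killed operator -/
noncomputable def kil (T : L2 Γ →L[ℝ] L2 Γ) (Λ : Set Γ) : L2 Γ →L[ℝ] L2 Γ := ind Λ * T * ind Λ

/-- restricted Green function -/
noncomputable def gr (T : L2 Γ →L[ℝ] L2 Γ) (Λ : Set Γ) (x y : Γ) : ℝ := neu (kil T Λ) (dl y) x

section
variable {d : Γ → Γ → ℕ} {M : ℕ} {κ ρ : ℝ} {T : L2 Γ →L[ℝ] L2 Γ}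

theorem Walk.rho0 (W : Walk d M κ ρ T) : 0 ≤ ρ := (norm_nonneg _).trans W.norm

theorem Walk.kpos (W : Walk d M κ ρ T) (Λ : Set Γ) : Pos (kil T Λ) :=
  ((ind_pos Λ).mul W.pos).mul (ind_pos Λ)

theorem Walk.knorm (W : Walk d M κ ρ T) (Λ : Set Γ) : ‖kil T Λ‖ ≤ ρ := by
  have h1 : ‖ind Λ * T‖ ≤ 1 * ρ := (norm_mul_le _ _).trans
    (mul_le_mul (ind_norm Λ) W.norm (norm_nonneg _) zero_le_one)
  have h2 : ‖kil T Λ‖ ≤ (1 * ρ) * 1 := (norm_mul_le _ _).trans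
    (mul_le_mul h1 (ind_norm Λ) (norm_nonneg _) (by linarith [W.rho0]))
  linarith

theorem Walk.klt (W : Walk d M κ ρ T) (Λ : Set Γ) : ‖kil T Λ‖ < 1 := (W.knorm Λ).trans_lt W.rho

theorem Walk.npos (W : Walk d M κ ρ T) (Λ : Set Γ) : Pos (neu (kil T Λ)) :=
  neu_pos (W.klt Λ) (W.kpos Λ)

theorem Walk.gr_nonneg (W : Walk d M κ ρ T) (Λ : Set Γ) (x y : Γ) : 0 ≤ gr T Λ x y :=
  W.npos Λ _ (dl_nonneg y) x

theorem Walk.kpow (W : Walk d M κ ρ T) (Λ : Set Γ) (n : ℕ) (x y : Γ) :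
    ((kil T Λ) ^ n) (dl y) x ≤ ρ ^ n := by
  refine (le_abs_self _).trans ((l2_apply_le _ _).trans ?_)
  refine (ContinuousLinearMap.le_opNorm _ _).trans ?_
  rw [dl_norm, mul_one]
  rcases Nat.eq_zero_or_pos n with rfl | hn
  · simpa using opNorm_one_le
  · exact (norm_pow_le' _ hn).trans (pow_le_pow_left₀ (norm_nonneg _) (W.knorm Λ) n)

theorem Walk.gr_small (W : Walk d M κ ρ T) (Λ : Set Γ) (N : ℕ) (x y : Γ)
    (h : ∀ n < N, ((kil T Λ) ^ n) (dl y) x = 0) : gr T Λ x y ≤ ρ ^ N / (1 - ρ) := by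
  have h1 := neu_hasSum (W.klt Λ) (dl y) x
  have h2 := (hasSum_geometric_of_lt_one W.rho0 W.rho).mul_left (ρ ^ N)
  have h3 : HasSum (fun n => ((kil T Λ) ^ (n + N)) (dl y) x) (gr T Λ x y) := by
    have := (hasSum_nat_add_iff' N).2 h1
    rw [Finset.sum_eq_zero (fun n hn => h n (Finset.mem_range.1 hn)), sub_zero] at this
    exact this
  rw [div_eq_mul_inv]
  refine hasSum_le (fun n => ?_) h3 h2
  rw [← pow_add, add_comm N n]
  exact W.kpow Λ _ x y

theorem Walk.gr_le (W : Walk d M κ ρ T) (Λ : Set Γ) (x y : Γ) : gr T Λ x y ≤ 1 / (1 - ρ) := by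
  have := W.gr_small Λ 0 x y (by simp)
  simpa using this

theorem Walk.neu_eq (W : Walk d M κ ρ T) (Λ : Set Γ) :
    neu (kil T Λ) = 1 + kil T Λ * neu (kil T Λ) := by
  have := neu_left (W.klt Λ)
  rw [sub_mul, one_mul] at this
  rw [← this]; abel

theorem Walk.neu_eq' (W : Walk d M κ ρ T) (Λ : Set Γ) :
    neu (kil T Λ) = 1 + neu (kil T Λ) * kil T Λ := by
  have := neu_right (W.klt Λ)
  rw [mul_sub, mul_one] at this
  rw [← this]; abel

theorem Walk.gr_self (W : Walk d M κ ρ T) (Λ : Set Γ) (y : Γ) : 1 ≤ gr T Λ y y := by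
  unfold gr
  rw [W.neu_eq]
  show 1 ≤ dl y y + (kil T Λ * neu (kil T Λ)) (dl y) y
  rw [dl_self]
  linarith [((W.kpos Λ).mul (W.npos Λ)) (dl y) (dl_nonneg y) y]

theorem Walk.gr_left (W : Walk d M κ ρ T) {δ : ℕ} (H : HypMetric d δ) {Λ : Set Γ} {a b : Γ}
    (ha : a ∈ Λ) (hb : b ∈ Λ) (hab : d a b ≤ 1) (z : Γ) : κ * gr T Λ b z ≤ gr T Λ a z := by
  unfold gr
  set u := neu (kil T Λ) (dl z) with hu
  have hu0 : ∀ x, 0 ≤ u x := W.npos Λ _ (dl_nonneg z)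
  have e : u a = dl z a + kil T Λ u a := by
    conv_lhs => rw [hu, W.neu_eq]
    rfl
  have h1 := W.low (ind Λ u) (ind_pos Λ u hu0) a (a⁻¹ * b) (by rw [← H.dist_eq]; exact hab)
  rw [mul_inv_cancel_left, ind_mem hb] at h1
  have e2 : kil T Λ u a = T (ind Λ u) a := by
    show ind Λ (T (ind Λ u)) a = _
    rw [ind_mem ha]
  rw [e, e2]
  linarith [dl_nonneg z a]

theorem Walk.gr_right (W : Walk d M κ ρ T) {δ : ℕ} (H : HypMetric d δ) {Λ : Set Γ} {a b : Γ}
    (ha : a ∈ Λ) (hb : b ∈ Λ) (hab : d a b ≤ 1) (x : Γ) : κ * gr T Λ x a ≤ gr T Λ x b := by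
  unfold gr
  have e : neu (kil T Λ) (dl b) x = dl b x + neu (kil T Λ) (kil T Λ (dl b)) x := by
    conv_lhs => rw [W.neu_eq']
    rfl
  have h1 := (W.npos Λ).mono (f := κ • dl a) (g := kil T Λ (dl b)) (fun y => ?_) x
  · rw [map_smul, l2_smul] at h1
    rw [e]; linarith [dl_nonneg b x]
  · rw [l2_smul]
    by_cases hy : y = a
    · subst hy
      have h2 := W.low (dl b) (dl_nonneg b) y (y⁻¹ * b) (by rw [← H.dist_eq]; exact hab)
      rw [mul_inv_cancel_left, dl_self] at h2
      show _ ≤ ind Λ (T (ind Λ (dl b))) y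
      rw [ind_mem ha, ind_dl hb, dl_self]; exact h2
    · rw [dl_ne hy, mul_zero]
      exact W.kpos Λ _ (dl_nonneg b) y

/-- Chains inside a set. -/
inductive Conn (d : Γ → Γ → ℕ) (Λ : Set Γ) : ℕ → Γ → Γ → Prop
  | refl (a : Γ) (h : a ∈ Λ) : Conn d Λ 0 a a
  | step (n : ℕ) (a b c : Γ) (ha : a ∈ Λ) (hb : b ∈ Λ) (hab : d a b ≤ 1) (h : Conn d Λ n b c) :
      Conn d Λ (n + 1) a c

theorem Walk.conn_left (W : Walk d M κ ρ T) {δ : ℕ} (H : HypMetric d δ) {Λ : Set Γ} {n : ℕ}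
    {a b : Γ} (h : Conn d Λ n a b) (z : Γ) : κ ^ n * gr T Λ b z ≤ gr T Λ a z := by
  induction h with
  | refl a h => simp
  | step n a b c ha hb hab h ih =>
    have h1 := W.gr_left H ha hb hab z
    rw [pow_succ', mul_assoc]
    exact (mul_le_mul_of_nonneg_left ih W.kap0.le).trans h1

theorem Walk.conn_right (W : Walk d M κ ρ T) {δ : ℕ} (H : HypMetric d δ) {Λ : Set Γ} {n : ℕ}
    {a b : Γ} (h : Conn d Λ n a b) (x : Γ) : κ ^ n * gr T Λ x b ≤ gr T Λ x a := by
  induction h with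
  | refl a h => simp
  | step n a b c ha hb hab h ih =>
    have h1 := W.gr_right H hb ha (by rw [H.comm]; exact hab) x
    rw [pow_succ', mul_assoc]
    exact (mul_le_mul_of_nonneg_left ih W.kap0.le).trans h1

theorem Conn.trans {Λ : Set Γ} {m n : ℕ} {a b c : Γ} (h : Conn d Λ m a b) (h2 : Conn d Λ n b c) :
    Conn d Λ (m + n) a c := by
  induction h with
  | refl a h => simpa using h2
  | step k a b c' ha hb hab h ih =>
    have := Conn.step (k + n) a b c ha hb hab (ih h2)
    rw [show k + 1 + n = k + n + 1 by omega]; exact this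

theorem HypMetric.conn_geo {δ : ℕ} (H : HypMetric d δ) {Λ : Set Γ} : ∀ (n : ℕ) (x y : Γ),
    d x y = n → (∀ z, d x z + d z y = d x y → z ∈ Λ) → Conn d Λ n x y := by
  intro n
  induction n with
  | zero =>
    intro x y h hz
    have := H.eq _ _ h
    subst this
    exact Conn.refl x (hz x (by rw [H.self]))
  | succ n ih =>
    intro x y h hz
    obtain ⟨z, h1, h2⟩ := H.pt x y 1 (by omega)
    refine Conn.step n x z y (hz x (by rw [H.self]; omega)) (hz z (by omega)) (by omega)
      (ih z y (by omega) fun w hw => hz w ?_)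
    have := H.tri x z w
    have := H.tri x w y
    omega

/-- difference operator at a point of `D` -/
theorem Walk.first_passage (W : Walk d M κ ρ T) {Λ A : Set Γ} (f : L2 Γ) {a : Γ}
    (haL : a ∈ Λ) (haA : a ∉ A) :
    neu (kil T Λ) f a = neu (kil T (Λ \ A)) f a +
      (neu (kil T (Λ \ A)) * ind (Λ \ A) * T) (ind (A ∩ Λ) (neu (kil T Λ) f)) a := by
  set D := Λ \ A
  have haD : a ∈ D := ⟨haL, haA⟩
  set gL := neu (kil T Λ)
  set gD := neu (kil T D)
  have h1 : gL = gD + gD * ((kil T Λ - kil T D) * gL) := by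
    have e1 : (1 - kil T Λ) * gL = 1 := neu_left (W.klt Λ)
    have e2 : gD * (1 - kil T D) = 1 := neu_right (W.klt D)
    calc gL = (gD * (1 - kil T D)) * gL := by rw [e2, one_mul]
      _ = gD * ((1 - kil T Λ) * gL) + gD * ((kil T Λ - kil T D) * gL) := by noncomm_ring
      _ = _ := by rw [e1, mul_one]
  have h2 : gD = gD * ind D + (1 - ind D) := by
    have e3 : kil T D * (1 - ind D) = 0 := by
      unfold kil
      rw [mul_sub, mul_one, mul_assoc _ (ind D) (ind D), ind_idem, sub_self]
    have e4 : gD * (1 - ind D) = 1 - ind D := by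
      have : gD = 1 + gD * kil T D := W.neu_eq' D
      rw [this, add_mul, one_mul, mul_assoc, e3, mul_zero, add_zero]
    calc gD = gD * ind D + gD * (1 - ind D) := by noncomm_ring
      _ = _ := by rw [e4]
  have h3 : ind D * (kil T Λ - kil T D) = ind D * T * ind (A ∩ Λ) := by
    have e5 : ind D * ind Λ = ind D := by
      ext1 f; apply l2_ext; intro x
      rw [mul_apply_eq_comp]
      by_cases h : x ∈ D
      · rw [ind_mem h, ind_mem h, ind_mem h.1]
      · rw [ind_not_mem h, ind_not_mem h]
    have e6 : ind Λ = ind D + ind (A ∩ Λ) := by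
      ext1 f; apply l2_ext; intro x
      show ind Λ f x = ind D f x + ind (A ∩ Λ) f x
      by_cases h : x ∈ Λ
      · by_cases h' : x ∈ A
        · rw [ind_mem h, ind_not_mem (Λ := D) (fun h2 => h2.2 h'), ind_mem (Λ := A ∩ Λ) ⟨h', h⟩,
            zero_add]
        · rw [ind_mem h, ind_mem (Λ := D) ⟨h, h'⟩, ind_not_mem (Λ := A ∩ Λ) (fun h2 => h' h2.1),
            add_zero]
      · rw [ind_not_mem h, ind_not_mem (Λ := D) (fun h2 => h h2.1),
          ind_not_mem (Λ := A ∩ Λ) (fun h2 => h h2.2), zero_add]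
    unfold kil
    rw [mul_sub, ← mul_assoc, ← mul_assoc, e5, ← mul_assoc, ← mul_assoc, ind_idem, ← mul_sub, e6,
      add_sub_cancel_left]
  set g := (kil T Λ - kil T D) (gL f) with hg
  have h4 : gL f a = gD f a + gD g a := by
    conv_lhs => rw [h1]
    rfl
  have h5 : gD g a = gD (ind D g) a := by
    conv_lhs => rw [h2]
    show gD (ind D g) a + (g a - ind D g a) = _
    rw [ind_mem haD, sub_self, add_zero]
  have h6 : ind D g = ind D (T (ind (A ∩ Λ) (gL f))) := by
    rw [hg, ← mul_apply_eq_comp, h3]; rfl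
  rw [h4, h5, h6]; rfl

theorem Walk.fp_pos (W : Walk d M κ ρ T) (D : Set Γ) : Pos (neu (kil T D) * ind D * T) :=
  ((W.npos D).mul (ind_pos D)).mul W.pos

/-- the comparison through a barrier, left version -/
theorem Walk.barrier_left (W : Walk d M κ ρ T) {Λ A : Set Γ} {a b q : Γ} (haL : a ∈ Λ)
    (haA : a ∉ A) {c : ℝ} (hc : 0 ≤ c)
    (h : ∀ a' ∈ A, a' ∈ Λ → gr T Λ a' b ≤ c * gr T Λ a' q) :
    gr T Λ a b ≤ gr T (Λ \ A) a b + c * gr T Λ a q := by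
  have h1 := W.first_passage (dl b) haL haA
  have h2 := W.first_passage (dl q) haL haA
  have h3 := (W.fp_pos (Λ \ A)).mono (f := ind (A ∩ Λ) (neu (kil T Λ) (dl b)))
    (g := c • ind (A ∩ Λ) (neu (kil T Λ) (dl q))) (fun x => ?_) a
  · rw [map_smul, l2_smul] at h3
    have h4 := W.gr_nonneg (Λ \ A) a q
    unfold gr at *
    rw [h1]
    have : c * neu (kil T Λ) (dl q) a = c * neu (kil T (Λ \ A)) (dl q) a +
      c * (neu (kil T (Λ \ A)) * ind (Λ \ A) * T) (ind (A ∩ Λ) (neu (kil T Λ) (dl q))) a := by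
      rw [h2]; ring
    nlinarith [mul_nonneg hc h4]
  · rw [l2_smul]
    by_cases hx : x ∈ A ∩ Λ
    · rw [ind_mem hx, ind_mem hx]; exact h x hx.1 hx.2
    · rw [ind_not_mem hx, ind_not_mem hx, mul_zero]

theorem Walk.gr_lower (W : Walk d M κ ρ T) {Λ : Set Γ} {x b q : Γ} (hx : x ∈ Λ) (hq : q ∈ Λ) :
    (1 - ρ) * (gr T Λ x q * gr T Λ q b) ≤ gr T Λ x b := by
  have hρ : 0 < 1 - ρ := by linarith [W.rho]
  have hqq := W.gr_le Λ q q
  rw [le_div_iff₀ hρ] at hqq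
  by_cases hxq : x = q
  · subst hxq
    nlinarith [W.gr_nonneg Λ x b]
  · have h1 := W.first_passage (Λ := Λ) (A := {q}) (dl b) hx hxq
    have h2 := W.first_passage (Λ := Λ) (A := {q}) (dl q) hx hxq
    have e : ∀ f : L2 Γ, ind ({q} ∩ Λ) f = f q • dl q := by
      intro f; apply l2_ext; intro y
      rw [l2_smul]
      by_cases hy : y = q
      · subst hy; rw [ind_mem (Λ := {y} ∩ Λ) ⟨rfl, hq⟩, dl_self, mul_one]
      · rw [dl_ne hy, mul_zero, ind_not_mem]; exact fun h => hy h.1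
    rw [e, map_smul, l2_smul] at h1 h2
    have h3 : neu (kil T (Λ \ {q})) (dl q) x = 0 := by
      rw [W.neu_eq']
      show dl q x + neu (kil T (Λ \ {q})) (ind (Λ \ {q}) (T (ind (Λ \ {q}) (dl q)))) x = 0
      rw [dl_ne hxq, ind_dl_not (by simp)]
      simp
    rw [h3, zero_add] at h2
    set B := (neu (kil T (Λ \ {q})) * ind (Λ \ {q}) * T) (dl q) x with hB
    have hB0 : 0 ≤ B := W.fp_pos _ _ (dl_nonneg q) x
    have h4 := W.gr_nonneg (Λ \ {q}) x b
    have h5 := W.gr_nonneg Λ q b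
    unfold gr at *
    rw [h1, h2]
    nlinarith [mul_nonneg hB0 h5]

end

section
variable {d : Γ → Γ → ℕ} {M : ℕ} {κ ρ : ℝ} {T : L2 Γ →L[ℝ] L2 Γ}

theorem Walk.barrier_right (W : Walk d M κ ρ T) {Λ A : Set Γ} {a b q : Γ} (hbL : b ∈ Λ)
    (hbA : b ∉ A) {c : ℝ} (hc : 0 ≤ c)
    (h : ∀ a' ∈ A, a' ∈ Λ → gr T Λ a a' ≤ c * gr T Λ q a') :
    gr T Λ a b ≤ gr T (Λ \ A) a b + c * gr T Λ q b := by
  set D := Λ \ A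
  have hbD : b ∈ D := ⟨hbL, hbA⟩
  set gL := neu (kil T Λ) with hgL
  set gD := neu (kil T D) with hgD
  have h1 : gL = gD + gL * ((kil T Λ - kil T D) * gD) := by
    have e1 : gL * (1 - kil T Λ) = 1 := neu_right (W.klt Λ)
    have e2 : (1 - kil T D) * gD = 1 := neu_left (W.klt D)
    calc gL = gL * ((1 - kil T D) * gD) := by rw [e2, mul_one]
      _ = (gL * (1 - kil T Λ)) * gD + gL * ((kil T Λ - kil T D) * gD) := by noncomm_ring
      _ = _ := by rw [e1, one_mul]
  set g0 := gD (dl b) with hg0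
  have hg00 : ∀ x, 0 ≤ g0 x := W.npos D _ (dl_nonneg b)
  have hsup : ∀ x, x ∉ D → g0 x = 0 := by
    intro x hx
    rw [hg0, hgD, W.neu_eq]
    show dl b x + ind D (T (ind D (neu (kil T D) (dl b)))) x = 0
    rw [ind_not_mem hx, dl_ne, add_zero]
    rintro rfl; exact hx hbD
  have hi : ∀ Λ' : Set Γ, D ⊆ Λ' → ind Λ' g0 = g0 := by
    intro Λ' h'
    apply l2_ext; intro x
    by_cases hx : x ∈ Λ'
    · rw [ind_mem hx]
    · rw [ind_not_mem hx, hsup x (fun h2 => hx (h' h2))]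
  set w := (kil T Λ - kil T D) g0 with hw
  have hwx : ∀ x, w x = ind Λ (T g0) x - ind D (T g0) x := by
    intro x
    rw [hw]
    show ind Λ (T (ind Λ g0)) x - ind D (T (ind D g0)) x = _
    rw [hi D subset_rfl, hi Λ Set.sdiff_subset]
  have hT : ∀ x, 0 ≤ T g0 x := W.pos _ hg00
  have hw0 : ∀ x, 0 ≤ w x := by
    intro x
    rw [hwx]
    by_cases h' : x ∈ Λ
    · rw [ind_mem h']
      by_cases h'' : x ∈ D
      · rw [ind_mem h'']; simp
      · rw [ind_not_mem h'']; simpa using hT x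
    · rw [ind_not_mem h', ind_not_mem (fun h'' => h' h''.1)]; simp
  have hws : ∀ x, ¬ (x ∈ A ∧ x ∈ Λ) → w x = 0 := by
    intro x hx
    rw [hwx]
    by_cases h' : x ∈ Λ
    · rw [ind_mem h', ind_mem (Λ := D) ⟨h', fun h2 => hx ⟨h2, h'⟩⟩, sub_self]
    · rw [ind_not_mem h', ind_not_mem (fun h'' => h' h''.1), sub_self]
  have key : ∀ x, gr T Λ x b = gr T D x b + gL w x := by
    intro x
    show gL (dl b) x = gD (dl b) x + gL w x
    conv_lhs => rw [h1]
    rfl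
  have hle : gL w a ≤ c * gL w q := by
    refine hasSum_le (fun z => ?_) (op_hasSum gL w a) ((op_hasSum gL w q).mul_left c)
    by_cases hz : z ∈ A ∧ z ∈ Λ
    · have := mul_le_mul_of_nonneg_left (h z hz.1 hz.2) (hw0 z)
      unfold gr at this
      rw [← hgL] at this
      linarith
    · rw [hws z hz]; simp
  rw [key a, key q]
  have := mul_nonneg hc (W.gr_nonneg D q b)
  linarith

theorem Walk.kpow_not (D : Set Γ) {a z : Γ} (ha : a ∈ D) (hz : z ∉ D) (n : ℕ) :
    ((kil T D) ^ n) (dl z) a = 0 := by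
  cases n with
  | zero =>
    rw [pow_zero, one_apply_eq_self, dl_ne]
    rintro rfl; exact hz ha
  | succ n =>
    rw [pow_succ, mul_apply_eq_comp]
    have : kil T D (dl z) = 0 := by
      show ind D (T (ind D (dl z))) = 0
      rw [ind_dl_not hz]; simp
    rw [this]; simp

theorem Walk.path (W : Walk d M κ ρ T) {δ : ℕ} (H : HypMetric d δ) {D : Set Γ} {y : Γ} {r : ℕ}
    (hD : ∀ z ∈ D, r ≤ d z y) : ∀ (k n : ℕ), n ≤ 2 ^ k → ∀ a b, a ∈ D → b ∈ D →
      ((kil T D) ^ n) (dl b) a ≠ 0 → d a b + 2 * r ≤ d a y + d b y + M + 2 * (δ * k) := by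
  intro k
  induction k with
  | zero =>
    intro n hn a b ha hb h
    have h1 := hD a ha
    have h2 := hD b hb
    rcases Nat.eq_zero_or_pos n with rfl | hp
    · rw [pow_zero, one_apply_eq_self] at h
      have : a = b := by
        by_contra hne; exact h (dl_ne hne)
      subst this
      rw [H.self]; omega
    · have : n = 1 := by simp at hn; omega
      subst this
      rw [pow_one] at h
      have h3 : ind D (T (ind D (dl b))) a ≠ 0 := h
      rw [ind_mem ha, ind_dl hb] at h3
      have := W.supp _ _ h3
      omega
  | succ k ih =>
    intro n hn a b ha hb h
    have hs : (2:ℕ) ^ (k+1) = 2 ^ k + 2 ^ k := by ring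
    obtain ⟨n1, n2, e, hn1, hn2⟩ : ∃ n1 n2, n = n1 + n2 ∧ n1 ≤ 2 ^ k ∧ n2 ≤ 2 ^ k :=
      ⟨n / 2, n - n / 2, by omega, by omega, by omega⟩
    subst e
    rw [pow_add, mul_apply_eq_comp] at h
    obtain ⟨z, hz⟩ : ∃ z, ((kil T D) ^ n2) (dl b) z * ((kil T D) ^ n1) (dl z) a ≠ 0 := by
      by_contra hc
      push Not at hc
      have := op_hasSum ((kil T D) ^ n1) (((kil T D) ^ n2) (dl b)) a
      simp only [hc] at this
      exact h (this.unique hasSum_zero)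
    have hz1 := left_ne_zero_of_mul hz
    have hz2 := right_ne_zero_of_mul hz
    have hzD : z ∈ D := by
      by_contra hc; exact hz2 (Walk.kpow_not D ha hc n1)
    have i1 := ih n1 hn1 a z ha hzD hz2
    have i2 := ih n2 hn2 z b hzD hb hz1
    have h3 := H.hyp a b z y
    have h4 := H.comm b z
    have : δ * (k+1) = δ * k + δ := by ring
    rw [this]
    omega

theorem Walk.gr_far (W : Walk d M κ ρ T) {δ : ℕ} (H : HypMetric d δ) {D : Set Γ} {y : Γ} {r : ℕ}
    (hD : ∀ z ∈ D, r ≤ d z y) (k : ℕ) {a b : Γ} (ha : a ∈ D) (hb : b ∈ D)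
    (h : d a y + d b y + M + 2 * (δ * k) < d a b + 2 * r) :
    gr T D a b ≤ ρ ^ (2 ^ k) / (1 - ρ) := by
  refine W.gr_small D _ a b fun n hn => ?_
  by_contra hc
  have := W.path H hD k n hn.le a b ha hb hc
  omega

theorem numeric {κ ρ : ℝ} (hκ : 0 < κ) (hρ0 : 0 ≤ ρ) (hρ : ρ < 1) (hκ1 : κ ≤ 1) (e c : ℕ)
    (he : 1 ≤ e) : ∃ C : ℝ, 0 ≤ C ∧ ∀ N : ℕ,
      ρ ^ (2 ^ (N / e)) / (1 - ρ) ≤ C * (1 / 2) ^ N * κ ^ (N + c) := by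
  set θ := (κ / 2) ^ e with hθ
  have hθ0 : 0 < θ := by positivity
  have hk2 : κ / 2 ≤ 1 := by linarith
  obtain ⟨L, hL⟩ := pow_unbounded_of_one_lt (1 / θ) (one_lt_two (α := ℝ))
  have ht := tendsto_pow_const_mul_const_pow_of_abs_lt_one L (r := ρ) (by rw [abs_of_nonneg hρ0]; exact hρ)
  obtain ⟨K, hK⟩ := ht.bddAbove_range
  have hK' : ∀ n : ℕ, (n:ℝ) ^ L * ρ ^ n ≤ K := fun n => hK ⟨n, rfl⟩
  have hK0 : 0 ≤ K := le_trans (by positivity) (hK' 0)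
  have h1ρ : 0 < 1 - ρ := by linarith
  refine ⟨2 ^ L * K / (1 - ρ) / κ ^ c, by positivity, fun N => ?_⟩
  set j := N / e with hj
  have hN : N ≤ e * (j + 1) := by
    have := Nat.div_add_mod N e
    have := Nat.mod_lt N (by omega : 0 < e)
    rw [mul_add]; rw [hj]; omega
  have h1 : θ ^ (j + 1) ≤ (κ / 2) ^ N := by
    rw [hθ, ← pow_mul]
    exact pow_le_pow_of_le_one (by positivity) hk2 hN
  have h2 := hK' (2 ^ j)
  push_cast at h2
  have h3 : (1:ℝ) ≤ θ * 2 ^ L := by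
    rw [div_lt_iff₀ hθ0] at hL; linarith
  have h4 : (1:ℝ) ≤ (θ * 2 ^ L) ^ (j + 1) := one_le_pow₀ h3
  have h5 : ρ ^ (2 ^ j) ≤ (2 ^ L * K) * θ ^ (j+1) := by
    have e1 : (θ * 2 ^ L) ^ (j + 1) = θ ^ (j+1) * 2 ^ L * ((2:ℝ) ^ j) ^ L := by
      rw [mul_pow, pow_succ (2 ^ L), pow_right_comm]; ring
    have hp : 0 ≤ ρ ^ (2 ^ j) := by positivity
    calc ρ ^ (2 ^ j) ≤ (θ * 2 ^ L) ^ (j + 1) * ρ ^ (2 ^ j) := le_mul_of_one_le_left hp h4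
      _ = θ ^ (j+1) * 2 ^ L * (((2:ℝ) ^ j) ^ L * ρ ^ (2 ^ j)) := by rw [e1]; ring
      _ ≤ θ ^ (j+1) * 2 ^ L * K := by gcongr
      _ = _ := by ring
  have h6 : ρ ^ (2 ^ j) ≤ (2 ^ L * K) * (κ / 2) ^ N :=
    h5.trans (mul_le_mul_of_nonneg_left h1 (by positivity))
  calc ρ ^ (2 ^ j) / (1 - ρ) ≤ (2 ^ L * K) * (κ / 2) ^ N / (1 - ρ) := by gcongr
    _ = _ := by
      rw [div_pow, pow_add, one_div, inv_pow]; field_simp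

/-- geometric step -/
theorem HypMetric.step {δ : ℕ} (H : HypMetric d δ) (hδ : 1 ≤ δ) (M c2 : ℕ) {a b q x0 : Γ}
    (hst : d b q ≤ d a q) (hN : 32 * (c2 + M + 4 * δ + 10) ≤ d a q + d b q)
    (hab : d a q + d b q ≤ d a b + c2) (hP : 3 * d a x0 ≤ d a q + 3 * d x0 q) :
    ∃ x' : Γ, d a q / 8 < d a x' ∧ d a q / 8 < d b x' ∧
      d a x' + d b x' + M + 2 * (δ * ((d a q + d b q) / (32 * δ))) < d a b + 2 * (d a q / 8) ∧
      ∀ a', d a' x' ≤ d a q / 8 → d a' q + d b q < d a q + d b q ∧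
        3 * d a' x0 ≤ d a' q + 3 * d x0 q := by
  obtain ⟨x', h1, h2⟩ := H.pt a q (d a q - d a q / 2) (by omega)
  have hk : 32 * (δ * ((d a q + d b q) / (32 * δ))) ≤ d a q + d b q := by
    have := Nat.mul_div_le (d a q + d b q) (32 * δ)
    rw [mul_assoc] at this; exact this
  have t1 := H.tri a x' b
  have t2 := H.comm b x'
  have t3 := H.tri b q x'
  have t4 := H.comm q x'
  refine ⟨x', by omega, by omega, by omega, fun a' ha' => ?_⟩
  have t5 := H.tri a' x' q
  have t6 := H.tri x' a' q
  have t7 := H.comm x' a'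
  have t8 := H.tri a' x' a
  have t9 := H.comm x' a
  have t10 := H.hyp a' x0 a q
  have t11 := H.comm a x0
  have t12 := H.comm a' a
  refine ⟨by omega, ?_⟩
  omega

theorem Walk.ancona (W : Walk d M κ ρ T) {δ : ℕ} (H : HypMetric d δ) (hδ : 1 ≤ δ) (c0 c1 : ℕ) :
    ∃ C : ℝ, 0 < C ∧ ∀ (Λ : Set Γ) (q : Γ), q ∈ Λ →
      (∀ a ∈ Λ, ∃ n ≤ d a q + c1, Conn d Λ n a q) → ∀ x0 b0, x0 ∈ Λ → b0 ∈ Λ →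
      d x0 q + d b0 q ≤ d x0 b0 + c0 →
      gr T Λ x0 b0 ≤ C * (gr T Λ x0 q * gr T Λ q b0) := by
  have hρ : 0 < 1 - ρ := by linarith [W.rho]
  have hκ := W.kap0
  obtain ⟨c2, hc2⟩ : ∃ n, n = 3 * (c0 + 4 * δ) := ⟨_, rfl⟩
  obtain ⟨n0, hn0⟩ : ∃ n, n = 32 * (c2 + M + 4 * δ + 10) := ⟨_, rfl⟩
  obtain ⟨C', hC'0, hC'⟩ := numeric W.kap0 W.rho0 W.rho W.kap1 (32 * δ) (2 * c1) (by omega)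
  set C0 : ℝ := 1 / (1 - ρ) / κ ^ (n0 + 2 * c1) with hC0
  have hC00 : 0 < C0 := by positivity
  refine ⟨C0 + C' * 2, by positivity, fun Λ q hq hconn x0 b0 hx0 hb0 hxb => ?_⟩
  have low1 : ∀ a ∈ Λ, κ ^ (d a q + c1) ≤ gr T Λ a q := by
    intro a ha
    obtain ⟨n, hn, hc⟩ := hconn a ha
    have h1 := W.conn_left H hc q
    have h2 := W.gr_self Λ q
    have h3 : κ ^ (d a q + c1) ≤ κ ^ n := pow_le_pow_of_le_one hκ.le W.kap1 hn
    exact h3.trans ((le_mul_of_one_le_right (pow_pos hκ n).le h2).trans h1)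
  have low2 : ∀ a ∈ Λ, κ ^ (d a q + c1) ≤ gr T Λ q a := by
    intro a ha
    obtain ⟨n, hn, hc⟩ := hconn a ha
    have h1 := W.conn_right H hc q
    have h2 := W.gr_self Λ q
    have h3 : κ ^ (d a q + c1) ≤ κ ^ n := pow_le_pow_of_le_one hκ.le W.kap1 hn
    exact h3.trans ((le_mul_of_one_le_right (pow_pos hκ n).le h2).trans h1)
  have low : ∀ a ∈ Λ, ∀ b ∈ Λ, κ ^ (d a q + d b q + 2 * c1) ≤ gr T Λ a q * gr T Λ q b := by
    intro a ha b hb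
    have := mul_le_mul (low1 a ha) (low2 b hb) (by positivity) (W.gr_nonneg Λ a q)
    rw [← pow_add] at this
    rw [show d a q + d b q + 2 * c1 = d a q + c1 + (d b q + c1) by ring]; exact this
  have main : ∀ N : ℕ, ∀ a b, a ∈ Λ → b ∈ Λ → d a q + d b q ≤ N →
      3 * d a x0 ≤ d a q + 3 * d x0 q → 3 * d b b0 ≤ d b q + 3 * d b0 q →
      gr T Λ a b ≤ (C0 + C' * (2 - (1 / 2) ^ N)) * (gr T Λ a q * gr T Λ q b) := by
    intro N
    induction N with
    | zero =>
      intro a b ha hb hN _ _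
      have h1 := low a ha b hb
      have h2 := W.gr_le Λ a b
      have h3 : κ ^ (n0 + 2 * c1) ≤ κ ^ (d a q + d b q + 2 * c1) :=
        pow_le_pow_of_le_one hκ.le W.kap1 (by omega)
      have h4 : 1 / (1 - ρ) = C0 * κ ^ (n0 + 2 * c1) := by rw [hC0]; field_simp
      have h5 : C0 * κ ^ (n0 + 2 * c1) ≤ C0 * (gr T Λ a q * gr T Λ q b) :=
        mul_le_mul_of_nonneg_left (h3.trans h1) hC00.le
      have h6 : 0 ≤ gr T Λ a q * gr T Λ q b := mul_nonneg (W.gr_nonneg _ _ _) (W.gr_nonneg _ _ _)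
      have h7 := mul_nonneg hC'0 h6
      rw [pow_zero]
      nlinarith
    | succ N ih =>
      intro a b ha hb hN hPa hPb
      have h6 : 0 ≤ gr T Λ a q * gr T Λ q b := mul_nonneg (W.gr_nonneg _ _ _) (W.gr_nonneg _ _ _)
      have h7 := mul_nonneg hC'0 h6
      have hpw : (0:ℝ) ≤ (1/2)^N := by positivity
      have hpw1 : ((1:ℝ)/2)^N ≤ 1 := pow_le_one₀ (by norm_num) (by norm_num)
      set E := C0 + C' * (2 - (1 / 2) ^ N) with hE
      have hE0 : 0 ≤ E := by
        have : 0 ≤ C' * (2 - (1 / 2) ^ N) := mul_nonneg hC'0 (by linarith)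
        linarith
      have hEN : C0 + C' * (2 - (1 / 2) ^ (N+1)) = E + C' * (1/2)^(N+1) := by
        rw [hE, pow_succ]; ring
      rcases Nat.lt_or_ge N (d a q + d b q) with hlt | hge
      swap
      · refine (ih a b ha hb hge hPa hPb).trans ?_
        rw [hEN]
        have : 0 ≤ C' * (1/2)^(N+1) := by positivity
        exact mul_le_mul_of_nonneg_right (by linarith) h6
      have hNe : d a q + d b q = N + 1 := by omega
      by_cases hsm : d a q + d b q < n0
      · have h1 := low a ha b hb
        have h2 := W.gr_le Λ a b
        have h3 : κ ^ (n0 + 2 * c1) ≤ κ ^ (d a q + d b q + 2 * c1) :=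
          pow_le_pow_of_le_one hκ.le W.kap1 (by omega)
        have h4 : 1 / (1 - ρ) = C0 * κ ^ (n0 + 2 * c1) := by rw [hC0]; field_simp
        have h5 : C0 * κ ^ (n0 + 2 * c1) ≤ C0 * (gr T Λ a q * gr T Λ q b) :=
          mul_le_mul_of_nonneg_left (h3.trans h1) hC00.le
        have h8 : C0 ≤ C0 + C' * (2 - (1 / 2) ^ (N+1)) := by
          rw [hEN, hE]
          have : 0 ≤ C' * (2 - (1 / 2) ^ N) := mul_nonneg hC'0 (by linarith)
          have : 0 ≤ C' * (1/2)^(N+1) := by positivity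
          linarith
        have h9 := mul_le_mul_of_nonneg_right h8 h6
        linarith
      · have hab : d a q + d b q ≤ d a b + c2 := by
          have t1 := H.hyp x0 b0 a q
          have t2 := H.hyp a b0 b q
          have t3 := H.comm a x0
          have t4 := H.comm b0 a
          have t5 := H.comm b b0
          have t6 := H.comm a b
          have t7 := H.comm x0 b0
          have t8 := H.tri a b q
          have t9 := H.tri b a q
          omega
        have hsmall : ∀ D : Set Γ, gr T D a b ≤ ρ ^ (2 ^ ((d a q + d b q) / (32 * δ))) / (1 - ρ) →
            gr T D a b ≤ C' * (1/2)^(N+1) * (gr T Λ a q * gr T Λ q b) := by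
          intro D hD
          refine hD.trans ((hC' _).trans ?_)
          rw [hNe]
          refine mul_le_mul_of_nonneg_left ?_ (by positivity)
          rw [← hNe]; exact low a ha b hb
        rw [hEN, add_mul]
        rcases le_total (d b q) (d a q) with hst | hst
        · obtain ⟨x', g1, g2, g3, g4⟩ := H.step hδ M c2 hst (by omega) hab hPa
          set A : Set Γ := {z | d z x' ≤ d a q / 8} with hA
          have haA : a ∉ A := by simpa [hA] using g1
          have hbA : b ∉ A := by simpa [hA] using g2
          have k1 := W.barrier_left (A := A) (a := a) (b := b) (q := q) ha haA
            (c := E * gr T Λ q b) (mul_nonneg hE0 (W.gr_nonneg _ _ _)) (fun a' h1 h2 => by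
              have g5 := g4 a' h1
              have := ih a' b h2 hb (by omega) g5.2 hPb
              linarith)
          have k2 := hsmall (Λ \ A) (W.gr_far H (D := Λ \ A) (y := x') (r := d a q / 8)
            (fun z hz => by
              have : ¬ d z x' ≤ d a q / 8 := hz.2
              omega) _ ⟨ha, haA⟩ ⟨hb, hbA⟩ g3)
          linarith
        · obtain ⟨x', g1, g2, g3, g4⟩ := H.step (a := b) (b := a) hδ M c2 hst (by omega)
            (by rw [H.comm b a]; omega) hPb
          set A : Set Γ := {z | d z x' ≤ d b q / 8} with hA
          have hbA : b ∉ A := by simpa [hA] using g1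
          have haA : a ∉ A := by simpa [hA] using g2
          have k1 := W.barrier_right (A := A) (a := a) (b := b) (q := q) hb hbA
            (c := E * gr T Λ a q) (mul_nonneg hE0 (W.gr_nonneg _ _ _)) (fun a' h1 h2 => by
              have g5 := g4 a' h1
              have := ih a a' ha h2 (by omega) hPa g5.2
              linarith)
          have k2 := hsmall (Λ \ A) (W.gr_far H (D := Λ \ A) (y := x') (r := d b q / 8)
            (fun z hz => by
              have : ¬ d z x' ≤ d b q / 8 := hz.2
              omega) _ ⟨ha, haA⟩ ⟨hb, hbA⟩ (by
                rw [H.comm b a, add_comm (d b q)] at g3; omega))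
          linarith
  have h6 : 0 ≤ gr T Λ x0 q * gr T Λ q b0 := mul_nonneg (W.gr_nonneg _ _ _) (W.gr_nonneg _ _ _)
  refine (main _ x0 b0 hx0 hb0 le_rfl (by rw [H.self]; omega) (by rw [H.self]; omega)).trans ?_
  refine mul_le_mul_of_nonneg_right ?_ h6
  have : 0 ≤ C' * (1/2 : ℝ)^(d x0 q + d b0 q) := by positivity
  linarith

end

section
variable {d : Γ → Γ → ℕ} {M : ℕ} {κ ρ : ℝ} {T : L2 Γ →L[ℝ] L2 Γ}

/-- half spaces -/
def HS (d : Γ → Γ → ℕ) (p : Γ) (c : ℕ) : Set Γ := {g | d g 1 + c < d g p + d 1 p}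

theorem HypMetric.conn_half {δ : ℕ} (H : HypMetric d δ) {p q : Γ} {c w : ℕ} (hw : c + 8 * δ < 2 * w)
    (h1 : d 1 q + w = d 1 p) (h2 : d q p = w) (a : Γ) (ha : a ∈ HS d p c) :
    ∃ n ≤ d a q + (4 * δ + 1), Conn d (HS d p c) n a q := by
  have ha' : d a 1 + c < d a p + d 1 p := ha
  have t0 := H.comm a 1
  have t1 := H.comm q 1
  have t2 := H.comm a q
  have t3 := H.tri a 1 q
  have t4 := H.tri 1 a q
  have t5 := H.tri 1 q a
  obtain ⟨z, hz1, hz2⟩ := H.pt a 1 (d a 1 - (d a 1 + d 1 q - d a q) / 2) (by omega)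
  obtain ⟨q1, hq1, hq2⟩ := H.pt 1 q ((d a 1 + d 1 q - d a q) / 2) (by omega)
  have hjump : d z q1 ≤ 4 * δ := by
    have s1 := H.hyp z q1 a 1
    have s2 := H.hyp a q1 q 1
    have s3 := H.comm z a
    have s4 := H.comm q1 1
    have s5 := H.comm q1 q
    have s6 := H.comm q1 a
    have s7 := H.comm z 1
    omega
  have c1 := H.conn_geo (Λ := HS d p c) _ a z rfl (fun v hv => by
    show d v 1 + c < d v p + d 1 p
    have := H.tri v z 1
    have := H.tri a v p
    omega)
  have c2 := H.conn_geo (Λ := HS d p c) _ z q1 rfl (fun v hv => by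
    show d v 1 + c < d v p + d 1 p
    have s1 := H.tri v q1 1
    have s2 := H.tri q1 v p
    have s3 := H.comm q1 v
    have s4 := H.comm q1 1
    have s5 := H.tri 1 q1 p
    omega)
  have c3 := H.conn_geo (Λ := HS d p c) _ q1 q rfl (fun v hv => by
    show d v 1 + c < d v p + d 1 p
    have s1 := H.tri v q1 1
    have s2 := H.tri 1 v p
    have s3 := H.comm q1 v
    have s4 := H.comm q1 1
    have s5 := H.comm v 1
    omega)
  refine ⟨_, ?_, (c1.trans c2).trans c3⟩
  omega

theorem HypMetric.sep {δ : ℕ} (H : HypMetric d δ) {p q : Γ} {c e w : ℕ} (h1 : d 1 q + w = d 1 p)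
    (h2 : d q p = w) (hw1 : 2 * w ≤ c + e) (hw2 : c + 2 * M ≤ 2 * w) (he : 2 * δ + 2 * M ≤ e)
    {x b : Γ} (hx : x ∈ HS d p (c + e)) (hb : b ∉ HS d p (c + 2 * M)) :
    d x q + d b q ≤ d x b + 6 * δ := by
  have hx' : d x 1 + (c + e) < d x p + d 1 p := hx
  have hb' : ¬ d b 1 + (c + 2 * M) < d b p + d 1 p := hb
  have t1 := H.hyp x q 1 p
  have t2 := H.hyp b q 1 p
  have t3 := H.hyp x p b 1
  have t3' := H.hyp b 1 x p
  have t4 := H.comm q 1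
  have t5 := H.comm p 1
  have t6 := H.comm p b
  have t7 := H.comm x b
  have t8 := H.comm x 1
  omega

theorem Walk.repr (W : Walk d M κ ρ T) {Λ : Set Γ} (u : L2 Γ) (hu : ∀ x ∈ Λ, T u x = u x)
    (hpos : ∀ b ∈ Λ, ∀ z, d b z ≤ M → 0 ≤ u z) :
    ∃ f : L2 Γ, (∀ b, 0 ≤ f b) ∧ (∀ b, f b ≠ 0 → b ∈ Λ ∧ ∃ z, z ∉ Λ ∧ d b z ≤ M) ∧
      ∀ x ∈ Λ, HasSum (fun b => f b * gr T Λ x b) (u x) := by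
  set f := ind Λ (T (u - ind Λ u)) with hf
  have hterm : ∀ b ∈ Λ, ∀ z, 0 ≤ (u - ind Λ u) z * T (dl z) b ∧
      ((u - ind Λ u) z * T (dl z) b ≠ 0 → z ∉ Λ ∧ d b z ≤ M) := by
    intro b hb z
    have e : (u - ind Λ u) z = u z - ind Λ u z := l2_sub _ _ _
    rw [e]
    by_cases hz : z ∈ Λ
    · rw [ind_mem hz]; simp
    · rw [ind_not_mem hz, sub_zero]
      by_cases hT : T (dl z) b = 0
      · rw [hT]; simp
      · have h1 := W.supp _ _ hT
        exact ⟨mul_nonneg (hpos b hb z h1) (W.pos _ (dl_nonneg z) b), fun _ => ⟨hz, h1⟩⟩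
  refine ⟨f, fun b => ?_, fun b hb => ?_, fun x hx => ?_⟩
  · by_cases hb : b ∈ Λ
    · rw [hf, ind_mem hb]
      exact (op_hasSum T (u - ind Λ u) b).nonneg (fun z => (hterm b hb z).1)
    · rw [hf, ind_not_mem hb]
  · have hbΛ : b ∈ Λ := by
      by_contra hc; exact hb (by rw [hf, ind_not_mem hc])
    refine ⟨hbΛ, ?_⟩
    rw [hf, ind_mem hbΛ] at hb
    obtain ⟨z, hz⟩ : ∃ z, (u - ind Λ u) z * T (dl z) b ≠ 0 := by
      by_contra hc
      push Not at hc
      have := op_hasSum T (u - ind Λ u) b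
      simp only [hc] at this
      exact hb (this.unique hasSum_zero)
    exact ⟨z, (hterm b hbΛ z).2 hz⟩
  · have h1 : f = (1 - kil T Λ) (ind Λ u) := by
      apply l2_ext; intro y
      show ind Λ (T (u - ind Λ u)) y = (ind Λ u - ind Λ (T (ind Λ (ind Λ u)))) y
      rw [l2_sub, ← mul_apply_eq_comp (ind Λ) (ind Λ), ind_idem, map_sub]
      by_cases hy : y ∈ Λ
      · rw [ind_mem hy, ind_mem hy, ind_mem hy, l2_sub, hu y hy]
      · rw [ind_not_mem hy, ind_not_mem hy, ind_not_mem hy, sub_self]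
    have h2 : neu (kil T Λ) f = ind Λ u := by
      rw [h1, ← mul_apply_eq_comp, neu_right (W.klt Λ), one_apply_eq_self]
    have h3 := op_hasSum (neu (kil T Λ)) f x
    rw [h2, ind_mem hx] at h3
    exact h3

theorem HS_mono {p : Γ} {c c' : ℕ} (h : c ≤ c') : HS d p c' ⊆ HS d p c := by
  intro g hg
  have hg' : d g 1 + c' < d g p + d 1 p := hg
  show d g 1 + c < d g p + d 1 p
  omega

theorem Walk.harnack (W : Walk d M κ ρ T) {δ : ℕ} (H : HypMetric d δ) (hδ : 1 ≤ δ) :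
    ∃ C : ℝ, 1 ≤ C ∧ ∀ (p : Γ) (r : ℕ), r + (2 * M + 4 * δ + 1) ≤ d 1 p →
      ∃ (q : Γ) (k : Γ → ℝ), q ∈ HS d p (2 * r) ∧ (∀ x, 0 ≤ k x) ∧
      ∀ u : L2 Γ, (∀ x ∈ HS d p (2 * r), T u x = u x) → (∀ z ∈ HS d p (2 * r), 0 ≤ u z) →
      ∀ x ∈ HS d p (2 * (r + (2 * M + 4 * δ + 1))),
        (1 - ρ) * (k x * u q) ≤ u x ∧ u x ≤ C * (k x * u q) := by
  obtain ⟨C, hC, hanc⟩ := W.ancona H hδ (6 * δ) (4 * δ + 1)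
  refine ⟨max C 1, le_max_right _ _, fun p r hr => ?_⟩
  set c := 2 * r + 2 * M with hc
  set w := r + 2 * M + 4 * δ + 1 with hw
  obtain ⟨q, hq1, hq2⟩ := H.pt 1 p (d 1 p - w) (by omega)
  have g1 : d 1 q + w = d 1 p := by omega
  have g2 : d q p = w := by omega
  have hqΛ : q ∈ HS d p c := by
    show d q 1 + c < d q p + d 1 p
    have := H.comm q 1
    omega
  refine ⟨q, fun x => gr T (HS d p c) x q, HS_mono (by omega) hqΛ, fun x => W.gr_nonneg _ _ _,
    fun u hu hpos x hx => ?_⟩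
  obtain ⟨f, hf0, hfs, hsum⟩ := W.repr (Λ := HS d p c) u (fun x hx => hu x (HS_mono (by omega) hx))
    (fun b hb z hz => hpos z (by
      have hb' : d b 1 + c < d b p + d 1 p := hb
      show d z 1 + 2 * r < d z p + d 1 p
      have := H.tri z b 1
      have := H.tri b z p
      have := H.comm z b
      omega))
  have hxΛ : x ∈ HS d p c := HS_mono (by omega) hx
  have sx := hsum x hxΛ
  have sq := hsum q hqΛ
  constructor
  · refine hasSum_le (fun b => ?_) ((sq.mul_left (gr T (HS d p c) x q)).mul_left (1 - ρ)) sx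
    have := mul_le_mul_of_nonneg_left (W.gr_lower (b := b) hxΛ hqΛ) (hf0 b)
    linarith
  · refine hasSum_le (fun b => ?_) sx ((sq.mul_left (gr T (HS d p c) x q)).mul_left (max C 1))
    by_cases hb : f b = 0
    · rw [hb]; simp
    · obtain ⟨hbΛ, z, hz, hbz⟩ := hfs b hb
      have hz' : ¬ d z 1 + c < d z p + d 1 p := hz
      have hb2 : b ∉ HS d p (c + 2 * M) := by
        intro hc2
        have hc3 : d b 1 + (c + 2 * M) < d b p + d 1 p := hc2
        have := H.tri z b 1
        have := H.tri b z p
        have := H.comm z b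
        have := H.tri b z 1
        omega
      have hs := H.sep (M := M) (c := c) (e := 2 * M + 8 * δ + 2) g1 g2 (by omega) (by omega) (by omega)
        (HS_mono (by omega) hx) hb2
      have h1 := hanc (HS d p c) q hqΛ (fun a ha => H.conn_half (by omega) g1 g2 a ha) x b hxΛ hbΛ hs
      have h2 : 0 ≤ gr T (HS d p c) x q * gr T (HS d p c) q b :=
        mul_nonneg (W.gr_nonneg _ _ _) (W.gr_nonneg _ _ _)
      have h3 := mul_le_mul_of_nonneg_right (le_max_left C 1) h2
      have := mul_le_mul_of_nonneg_left (h1.trans h3) (hf0 b)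
      linarith

theorem Walk.contract (W : Walk d M κ ρ T) {δ : ℕ} (H : HypMetric d δ) (hδ : 1 ≤ δ) :
    ∃ B τ : ℝ, 1 ≤ B ∧ 0 < τ ∧ τ ≤ 1 ∧ ∀ (p : Γ) (r : ℕ) (u1 u2 : L2 Γ),
      (∀ x ∈ HS d p (2 * r), T u1 x = u1 x) → (∀ x ∈ HS d p (2 * r), T u2 x = u2 x) →
      (∀ x, 0 ≤ u1 x) → (∀ x, 0 ≤ u2 x) → u1 1 = 1 → u2 1 = 1 →
      ∀ n : ℕ, r + (n + 1) * (2 * M + 4 * δ + 1) < d 1 p →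
      ∃ a b : ℝ, a ≤ b ∧ b - a = B * (1 - τ) ^ n ∧
        ∀ x ∈ HS d p (2 * (r + (n + 1) * (2 * M + 4 * δ + 1))),
          a * u2 x ≤ u1 x ∧ u1 x ≤ b * u2 x := by
  obtain ⟨C, hC, hh⟩ := W.harnack H hδ
  have hρ : 0 < 1 - ρ := by linarith [W.rho]
  have hρ0 := W.rho0
  have hC0 : 0 < C := by linarith
  set e := 2 * M + 4 * δ + 1 with he
  set t := C / (1 - ρ) with ht
  have ht1 : 1 ≤ t := by rw [ht, le_div_iff₀ hρ]; linarith
  set τ := (1 - ρ) / (2 * C) with hτ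
  have hτ1 : τ ≤ 1 := by rw [hτ, div_le_one (by positivity)]; linarith
  refine ⟨t * t, τ, by nlinarith, by positivity, hτ1, ?_⟩
  intro p r u1 u2 hu1 hu2 p1 p2 e1 e2 n
  induction n with
  | zero =>
    intro hn
    obtain ⟨q, k, hq, hk, hb⟩ := hh p r (by omega)
    refine ⟨0, t * t, by positivity, by ring, fun x hx => ⟨by simpa using p1 x, ?_⟩⟩
    have h1m : (1 : Γ) ∈ HS d p (2 * (r + e)) := by
      show d 1 1 + _ < d 1 p + d 1 p
      rw [H.self]; omega
    have a1 := hb u1 hu1 (fun z _ => p1 z) 1 h1m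
    have a2 := hb u2 hu2 (fun z _ => p2 z) 1 h1m
    have hx' : x ∈ HS d p (2 * (r + e)) := by simpa using hx
    have b1 := hb u1 hu1 (fun z _ => p1 z) x hx'
    have b2 := hb u2 hu2 (fun z _ => p2 z) x hx'
    rw [e1] at a1
    rw [e2] at a2
    have hk1 : 0 < k 1 := by
      rcases (hk 1).lt_or_eq with h | h
      · exact h
      · rw [← h] at a2; simp at a2; linarith [a2]
    have hq12 : (1 - ρ) * u1 q ≤ C * u2 q := by
      have : k 1 * ((1 - ρ) * u1 q) ≤ k 1 * (C * u2 q) := by linarith [a1.1, a2.2]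
      exact le_of_mul_le_mul_left this hk1
    have hC1 : C = t * (1 - ρ) := by rw [ht]; field_simp
    have hq12' : u1 q ≤ t * u2 q := by
      rw [hC1, mul_assoc, mul_left_comm] at hq12
      exact le_of_mul_le_mul_left hq12 hρ
    calc u1 x ≤ C * (k x * u1 q) := b1.2
      _ ≤ C * (k x * (t * u2 q)) := by
        have := hk x
        gcongr
      _ = t * t * ((1 - ρ) * (k x * u2 q)) := by rw [hC1]; ring
      _ ≤ t * t * u2 x := mul_le_mul_of_nonneg_left b2.1 (by positivity)
  | succ n ih =>
    intro hn
    have hs : (n + 1 + 1) * e = (n + 1) * e + e := by ring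
    obtain ⟨a, b, hab, hL, hx⟩ := ih (by omega)
    obtain ⟨q, k, hq, hk, hb⟩ := hh p (r + (n + 1) * e) (by omega)
    have hset : 2 * (r + (n + 1 + 1) * e) = 2 * (r + (n + 1) * e + e) := by rw [hs]; ring
    rw [hset]
    have hu1' : ∀ x ∈ HS d p (2 * (r + (n + 1) * e)), T u1 x = u1 x := fun x hx =>
      hu1 x (HS_mono (by omega) hx)
    have hu2' : ∀ x ∈ HS d p (2 * (r + (n + 1) * e)), T u2 x = u2 x := fun x hx =>
      hu2 x (HS_mono (by omega) hx)
    have hτC : τ * C = (1 - ρ) / 2 := by rw [hτ]; field_simp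
    have hτ0 : 0 < τ := by positivity
    have c2 := hb u2 hu2' (fun z _ => p2 z)
    have v1 : ∀ z, (u1 - a • u2) z = u1 z - a * u2 z := fun z => by rw [l2_sub, l2_smul]
    have v2 : ∀ z, (b • u2 - u1) z = b * u2 z - u1 z := fun z => by rw [l2_sub, l2_smul]
    have c3 := hb (u1 - a • u2) (fun x hx => by
      rw [v1, map_sub, map_smul, l2_sub, l2_smul, hu1' x hx, hu2' x hx])
      (fun z hz => by rw [v1]; linarith [(hx z hz).1])
    have c4 := hb (b • u2 - u1) (fun x hx => by
      rw [v2, map_sub, map_smul, l2_sub, l2_smul, hu1' x hx, hu2' x hx])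
      (fun z hz => by rw [v2]; linarith [(hx z hz).2])
    simp only [v1] at c3
    simp only [v2] at c4
    have hba : 0 ≤ b - a := by linarith
    have hfin : ∀ x ∈ HS d p (2 * (r + (n + 1) * e + e)), ∀ v vq : ℝ,
        (1 - ρ) * (k x * vq) ≤ v → (b - a) * u2 q / 2 ≤ vq → τ * (b - a) * u2 x ≤ v := by
      intro x hx v vq h1 h2
      have h3 := (c2 x hx).2
      calc τ * (b - a) * u2 x ≤ τ * (b - a) * (C * (k x * u2 q)) :=
            mul_le_mul_of_nonneg_left h3 (by positivity)
        _ = (τ * C) * (k x * ((b - a) * u2 q)) := by ring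
        _ = (1 - ρ) * (k x * ((b - a) * u2 q / 2)) := by rw [hτC]; ring
        _ ≤ (1 - ρ) * (k x * vq) := by
          have := hk x
          gcongr
        _ ≤ v := h1
    rcases le_total ((b - a) * u2 q / 2) (u1 q - a * u2 q) with hc | hc
    · refine ⟨a + τ * (b - a), b, by nlinarith, ?_, fun x hx' => ⟨?_, ?_⟩⟩
      · rw [pow_succ, ← mul_assoc, ← hL]; ring
      · have := hfin x hx' _ _ (c3 x hx').1 hc
        linarith
      · exact (hx x (HS_mono (by omega) hx')).2
    · refine ⟨a, b - τ * (b - a), by nlinarith, ?_, fun x hx' => ⟨?_, ?_⟩⟩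
      · rw [pow_succ, ← mul_assoc, ← hL]; ring
      · exact (hx x (HS_mono (by omega) hx')).1
      · have := hfin x hx' _ _ (c4 x hx').1 (by linarith)
        linarith

end

theorem Walk.super_low {d : Γ → Γ → ℕ} {M : ℕ} {κ ρ : ℝ} {T : L2 Γ →L[ℝ] L2 Γ}
    (W : Walk d M κ ρ T) {δ : ℕ} (H : HypMetric d δ) {G : L2 Γ} (h0 : ∀ x, 0 ≤ G x)
    (hs : ∀ x, T G x ≤ G x) : ∀ (n : ℕ) (x y : Γ), d x y = n → κ ^ n * G y ≤ G x := by
  intro n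
  induction n with
  | zero =>
    intro x y h
    have := H.eq _ _ h
    subst this; simp
  | succ n ih =>
    intro x y h
    obtain ⟨z, h1, h2⟩ := H.pt x y 1 (by omega)
    have i1 := ih z y (by omega)
    have i2 := W.low G h0 x (x⁻¹ * z) (by rw [← H.dist_eq]; omega)
    rw [mul_inv_cancel_left] at i2
    rw [pow_succ', mul_assoc]
    exact (mul_le_mul_of_nonneg_left i1 W.kap0.le).trans (i2.trans (hs x))

theorem mem_Cset_iff {S : Set Γ} {p g : Γ} {n : ℕ} :
    g ∈ Cset S p (n : ℝ) ↔ g ∈ HS (wdist S) p (2 * n) := by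
  show (n : ℝ) < gp S p g 1 ↔ wdist S g 1 + 2 * n < wdist S g p + wdist S 1 p
  unfold gp
  rw [← Nat.cast_lt (α := ℝ)]
  push_cast
  constructor <;> intro h <;> linarith

theorem far_of {d : Γ → Γ → ℕ} {δ : ℕ} (H : HypMetric d δ) {M : ℕ} {p y : Γ}
    (hy : d y p + d 1 p ≤ d y 1 + 4 * δ) {g : Γ} (hg : g ∈ HS d p (2 * (M + 2 * δ))) :
    M < d g y := by
  have hg' : d g 1 + 2 * (M + 2 * δ) < d g p + d 1 p := hg
  have t1 := H.tri y g 1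
  have t2 := H.tri g y p
  have t3 := H.comm g y
  omega

theorem gp_le_iff {S : Set Γ} {x y : Γ} {n : ℕ} :
    (n : ℝ) ≤ gp S 1 x y ↔ wdist S x y + 2 * n ≤ wdist S x 1 + wdist S y 1 := by
  unfold gp
  rw [← Nat.cast_le (α := ℝ)]
  push_cast
  constructor <;> intro h <;> linarith

theorem martin_kernel_ratio_estimate
    (Γ : Type) [Group Γ] (S : Set Γ) (δ : ℝ)
    (hS : IsGenSet S) (hδ : IsHyperbolic S δ) (hne : Nonelementary Γ)
    (μ : Γ → ℝ) (hμ : IsRWMeasure S μ)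
    (B : Boundary Γ S)
    (Kb : Γ → B.pt → ℝ)
    (hKb : ∀ (x : Γ) (ξ : B.pt) (u : ℕ → Γ), ConvInf S u → B.cls u = ξ →
      Tendsto (fun n => martinK μ x (u n)) atTop (𝓝 (Kb x ξ))) :
    ∃ R : ℕ, 0 < R ∧ ∃ B' : ℝ, 1 ≤ B' ∧ ∃ σ : ℝ, 0 ≤ σ ∧ σ < 1 ∧
      ∀ (m : ℕ) (ξ η : B.pt), ((3 * R * (m + 2) : ℕ) : ℝ≥0∞) < bgp B ξ η →
        ∀ x : ℕ → Γ, RayTo B x ξ →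
          ∀ k : ℕ, 1 ≤ k → k ≤ m →
            ∀ g h : Γ, g ∈ Cset S (x (3 * R * (m + 2))) ((3 * R * (k + 1) : ℕ) : ℝ) →
              h ∈ Cset S (x (3 * R * (m + 2))) ((3 * R * (k + 1) : ℕ) : ℝ) →
              |Kb g ξ / Kb g η - Kb h ξ / Kb h η| ≤ B' * σ ^ (k - 1) := by
  obtain ⟨D, hD1, H⟩ : ∃ D : ℕ, 1 ≤ D ∧ HypMetric (wdist S) D :=
    ⟨⌈δ⌉₊ + 1, by omega, hypMetric hS hδ⟩
  obtain ⟨M, κ, ρ, T, W, hG⟩ := exists_walk H hne hS hμ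
  obtain ⟨B', τ, hB', hτ0, hτ1, hcon⟩ := W.contract H hD1
  obtain ⟨e, he⟩ : ∃ e, e = 2 * M + 4 * D + 1 := ⟨_, rfl⟩
  rw [← he] at hcon
  refine ⟨M + 2 * D + e, by omega, B', hB', 1 - τ, by linarith, by linarith, ?_⟩
  obtain ⟨R, hR⟩ : ∃ R, R = M + 2 * D + e := ⟨_, rfl⟩
  rw [← hR]
  intro m ξ η hξη x hx k hk1 hkm g h hg hh
  obtain ⟨⟨hx0, hxd⟩, hxc, hxcls⟩ := hx
  obtain ⟨P, hP⟩ : ∃ P, P = 3 * R * (m + 2) := ⟨_, rfl⟩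
  rw [← hP] at hg hh hξη
  have hdp : wdist S 1 (x P) = P := by
    rw [← hx0, hxd]; simp [Nat.dist]
  -- the second sequence
  obtain ⟨v, hvc, hvcls, hv⟩ : ∃ v : ℕ → Γ, ConvInf S v ∧ B.cls v = η ∧
      ∀ᶠ n in atTop, wdist S (v n) (x P) + wdist S 1 (x P) ≤ wdist S (v n) 1 + 4 * D := by
    unfold bgp at hξη
    rw [lt_iSup_iff] at hξη
    obtain ⟨⟨u, huc, hucls⟩, h1⟩ := hξη
    rw [lt_iSup_iff] at h1
    obtain ⟨⟨v, hvc, hvcls⟩, h1⟩ := h1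
    refine ⟨v, hvc, hvcls, ?_⟩
    have h2 := Filter.eventually_lt_of_lt_liminf h1
    have h3 : EquivSeq S x u := (B.cls_eq x u hxc huc).1 (by rw [hxcls, hucls])
    have h4 := h3.eventually_ge_atTop (P : ℝ)
    obtain ⟨⟨i0, j0⟩, h5⟩ := eventually_atTop.1 h2
    obtain ⟨⟨i1, j1⟩, h6⟩ := eventually_atTop.1 h4
    filter_upwards [eventually_ge_atTop j0] with n hn
    have h7 := h5 (max i0 j1, n) ⟨le_max_left _ _, hn⟩
    have h8 := h6 (max i1 P, max i0 j1) ⟨le_max_left _ _, le_max_right _ _⟩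
    simp only at h7 h8
    set a := x (max i1 P) with ha
    set b := u (max i0 j1) with hb
    have h9 : (P : ℝ) ≤ gp S 1 b (v n) := by
      have h10 : ENNReal.ofReal (P : ℝ) < ENNReal.ofReal (gp S 1 b (v n)) := by
        rw [ENNReal.ofReal_natCast]; exact h7
      exact (ENNReal.ofReal_lt_ofReal_iff_of_nonneg (by positivity)).1 h10 |>.le
    rw [gp_le_iff] at h8 h9
    have h10 : wdist S a 1 = max i1 P := by
      rw [ha, ← hx0, hxd]; simp [Nat.dist]
    have h11 : wdist S a (x P) = max i1 P - P := by
      rw [ha, hxd]; simp [Nat.dist]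
    have t0 : P ≤ max i1 P := le_max_right _ _
    have t1 := H.hyp (x P) (v n) b 1
    have t2 := H.hyp (x P) b a 1
    have t3 := H.comm (v n) (x P)
    have t4 := H.comm (x P) a
    have t5 := H.comm (x P) 1
    have t6 := H.comm (v n) b
    have t7 := H.comm b a
    omega
  have hxv : ∀ᶠ n in atTop, wdist S (x n) (x P) + wdist S 1 (x P) ≤ wdist S (x n) 1 + 4 * D := by
    filter_upwards [eventually_ge_atTop P] with n hn
    have h10 : wdist S (x n) 1 = n := by
      rw [← hx0, hxd]; simp [Nat.dist]
    have h11 : wdist S (x n) (x P) = n - P := by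
      rw [hxd]; simp [Nat.dist]; omega
    omega
  -- normalised Green functions
  have hU : ∀ y, wdist S y (x P) + wdist S 1 (x P) ≤ wdist S y 1 + 4 * D →
      ∃ u : L2 Γ, (∀ z, u z = martinK μ z y) ∧ (∀ z, 0 ≤ u z) ∧ u 1 = 1 ∧
        (∀ z, κ ^ (wdist S z 1) ≤ u z) ∧
        ∀ z ∈ HS (wdist S) (x P) (2 * (M + 2 * D)), T u z = u z := by
    intro y hy
    obtain ⟨G, e1, e2, e3, e4, e5⟩ := hG y
    have p1 : 0 < G 1 := by
      have := W.super_low H e2 e5 _ 1 y rfl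
      have h2 : 0 < κ ^ (wdist S 1 y) * G y := mul_pos (pow_pos W.kap0 _) (by linarith)
      linarith
    have ev : ∀ z, ((G 1)⁻¹ • G) z = martinK μ z y := by
      intro z
      rw [l2_smul, martinK, ← e1, ← e1, div_eq_inv_mul]
    refine ⟨(G 1)⁻¹ • G, ev, fun z => ?_, ?_, fun z => ?_, fun z hz => ?_⟩
    · rw [l2_smul]; exact mul_nonneg (by positivity) (e2 z)
    · rw [l2_smul]; field_simp
    · have := W.super_low H e2 e5 _ z 1 rfl
      rw [l2_smul, ← div_eq_inv_mul, le_div_iff₀ p1]; exact this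
    · rw [map_smul, l2_smul, l2_smul, e4 z (far_of H hy hz)]
  have hKpos : ∀ z, 0 < Kb z η := by
    intro z
    refine lt_of_lt_of_le (pow_pos W.kap0 (wdist S z 1)) (ge_of_tendsto (hKb z η v hvc hvcls) ?_)
    filter_upwards [hv] with n hn
    obtain ⟨u, q1, q2, q3, q4, q5⟩ := hU (v n) hn
    rw [← q1]; exact q4 z
  have hlim : ∀ z, Tendsto (fun n => martinK μ z (x n) / martinK μ z (v n)) atTop
      (𝓝 (Kb z ξ / Kb z η)) := fun z =>
    (hKb z ξ x hxc hxcls).div (hKb z η v hvc hvcls) (hKpos z).ne'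
  refine le_of_tendsto ((hlim g).sub (hlim h)).abs ?_
  filter_upwards [hv, hxv] with n hn1 hn2
  obtain ⟨u1, q1, q2, q3, q4, q5⟩ := hU (x n) hn2
  obtain ⟨u2, r1, r2, r3, r4, r5⟩ := hU (v n) hn1
  have hke : k - 1 + 1 = k := by omega
  have hke2 : k * e ≤ R * (k + 1) := by
    have : e ≤ R := by omega
    nlinarith
  have hke3 : M + 2 * D + k * e ≤ 3 * R * (k + 1) := by nlinarith
  have hke4 : 3 * R * (k + 1) < P := by
    rw [hP]
    have : 0 < R := by omega
    exact Nat.mul_lt_mul_of_pos_left (by omega) (by omega)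
  obtain ⟨a, b, hab, hL, hin⟩ := hcon (x P) (M + 2 * D) u1 u2 q5 r5 q2 r2 q3 r3 (k - 1)
    (by rw [hke, hdp]; omega)
  rw [hke] at hin
  have hfin : ∀ z, z ∈ Cset S (x P) ((3 * R * (k + 1) : ℕ) : ℝ) →
      a ≤ martinK μ z (x n) / martinK μ z (v n) ∧ martinK μ z (x n) / martinK μ z (v n) ≤ b := by
    intro z hz
    have hz1 := hin z (HS_mono (by omega) (mem_Cset_iff.1 hz))
    have hz2 : 0 < u2 z := (pow_pos W.kap0 _).trans_le (r4 z)
    rw [← q1, ← r1, le_div_iff₀ hz2, div_le_iff₀ hz2]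
    exact hz1
  have f1 := hfin g hg
  have f2 := hfin h hh
  rw [← hL, abs_le]
  constructor <;> linarith [f1.1, f1.2, f2.1, f2.2]

end HarmonicBoundary
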